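/- arXiv:math-ph/9901004 — 2 statements merged into one kernel-verified Lean document; each statement's English description precedes it below -/
import Mathlib

section
/- Let δ ∈ (0,1] and let v ∈ ℝ³ with |v| ≤ 1 − δ. Then every (complex) eigenvalue λ of the matrix a(v)⁻¹ m(v) is real and satisfies λ ≥ (3π/e²) γ(v)⁻³ = (3π/e²)(1 − |v|²)^{3/2}. In particular, the eigenvalues of a(v)⁻¹ m(v) are bounded below by a positive constant depending only on δ and e, uniformly over all v with |v| ≤ 1 − δ. -/
open Real MeasureTheory Filter
open scoped RealInnerProductSpace

noncomputable section

abbrev E3 : Type := EuclideanSpace ℝ (Fin 3)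

/-- relativistic factor γ(v) = (1 - |v|²)^{-1/2} -/
def gam (v : E3) : ℝ := (Real.sqrt (1 - ‖v‖ ^ 2))⁻¹

/-- the function appearing in the square brackets of the soliton momentum -/
def phiFun (s : ℝ) : ℝ :=
  if s = 0 then 1 / 3
  else 1 / (2 * s ^ 2 * (1 - s ^ 2)) - (1 / (4 * s ^ 3)) * Real.log ((1 + s) / (1 - s))

/-- matrix of m₀(v) : m₀(v)w = γ w + γ³ (v·w) v -/
def m0Mat (v : E3) : Matrix (Fin 3) (Fin 3) ℝ :=
  Matrix.of fun i j => gam v * (if i = j then 1 else 0) + gam v ^ 3 * v i * v j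

/-- matrix of m_f(v) : m_f(v)w = 3 mₑ (φ(|v|) w + |v|⁻¹ φ'(|v|)(v·w) v), with m_f(0) = mₑ·Id -/
def mfMat (me : ℝ) (v : E3) : Matrix (Fin 3) (Fin 3) ℝ :=
  Matrix.of fun i j =>
    3 * me * (phiFun ‖v‖ * (if i = j then 1 else 0) + ‖v‖⁻¹ * deriv phiFun ‖v‖ * v i * v j)

/-- matrix of m(v) = m₀(v) + m_f(v) -/
def mMat (me : ℝ) (v : E3) : Matrix (Fin 3) (Fin 3) ℝ := m0Mat v + mfMat me v

/-- matrix of a(v) : a(v)w = (e²/12π)[γ⁴ w + 4 γ⁶ (v·w) v] -/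
def aMat (e : ℝ) (v : E3) : Matrix (Fin 3) (Fin 3) ℝ :=
  Matrix.of fun i j =>
    (e ^ 2 / (12 * π)) * (gam v ^ 4 * (if i = j then 1 else 0) + 4 * gam v ^ 6 * v i * v j)

lemma two_mul_le_log_div {s : ℝ} (h0 : 0 ≤ s) (h1 : s < 1) :
    2 * s ≤ log ((1 + s) / (1 - s)) := by
  have h : 0 < 1 - s := by linarith
  have key := Real.le_log_one_add_of_nonneg (x := 2 * s / (1 - s)) (by positivity)
  have e1 : 1 + 2 * s / (1 - s) = (1 + s) / (1 - s) := by field_simp; ring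
  have e2 : 2 * (2 * s / (1 - s)) / (2 * s / (1 - s) + 2) = 2 * s := by
    have : 2 * s / (1 - s) + 2 = 2 / (1 - s) := by field_simp; ring
    rw [this]; field_simp
  rwa [e1, e2] at key

lemma log_div_le {s : ℝ} (h0 : 0 ≤ s) (h1 : s < 1) :
    log ((1 + s) / (1 - s)) ≤ 2 * s / (1 - s ^ 2) := by
  have h : 0 < 1 - s := by linarith
  have h' : 0 < 1 + s := by linarith
  have hx : 1 ≤ (1 + s) / (1 - s) := by rw [le_div_iff₀ h]; linarith
  have key := Real.self_le_sinh_iff.2 (Real.log_nonneg hx)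
  rw [Real.sinh_log (by positivity)] at key
  refine key.trans_eq ?_
  rw [show 1 - s ^ 2 = (1 - s) * (1 + s) by ring]
  field_simp
  ring

lemma phiFun_nonneg {s : ℝ} (h0 : 0 ≤ s) (h1 : s < 1) : 0 ≤ phiFun s := by
  rcases h0.eq_or_lt with rfl | hs
  · norm_num [phiFun]
  have h : 0 < 1 - s ^ 2 := by nlinarith
  rw [phiFun, if_neg hs.ne', sub_nonneg]
  calc 1 / (4 * s ^ 3) * log ((1 + s) / (1 - s))
      ≤ 1 / (4 * s ^ 3) * (2 * s / (1 - s ^ 2)) := by gcongr; exact log_div_le h0 h1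
    _ = 1 / (2 * s ^ 2 * (1 - s ^ 2)) := by field_simp; norm_num

lemma hasDerivAt_log_div {s : ℝ} (h0 : 0 < s) (h1 : s < 1) :
    HasDerivAt (fun x : ℝ => log ((1 + x) / (1 - x))) (2 / (1 - s ^ 2)) s := by
  have h : 0 < 1 - s := by linarith
  have h' : 0 < 1 + s := by linarith
  have hd : HasDerivAt (fun x : ℝ => (1 + x) / (1 - x))
      ((1 * (1 - s) - (1 + s) * (-1)) / (1 - s) ^ 2) s :=
    ((hasDerivAt_id s).const_add 1).div ((hasDerivAt_id s).const_sub 1) h.ne'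
  refine (hd.log (by positivity)).congr_deriv ?_
  rw [show 1 - s ^ 2 = (1 - s) * (1 + s) by ring]
  field_simp
  ring

lemma hasDerivAt_phiFun {s : ℝ} (h0 : 0 < s) (h1 : s < 1) :
    HasDerivAt phiFun
      ((2 * s ^ 2 - 1) / (s ^ 3 * (1 - s ^ 2) ^ 2) - 1 / (2 * s ^ 3 * (1 - s ^ 2))
        + 3 / (4 * s ^ 4) * log ((1 + s) / (1 - s))) s := by
  have h : 0 < 1 - s ^ 2 := by nlinarith
  have hA : HasDerivAt (fun x : ℝ => 1 / (2 * x ^ 2 * (1 - x ^ 2))) _ s :=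
    (hasDerivAt_const s (1 : ℝ)).div
      ((((hasDerivAt_pow 2 s).const_mul 2)).mul ((hasDerivAt_pow 2 s).const_sub 1))
      (by positivity)
  have hB : HasDerivAt (fun x : ℝ => 1 / (4 * x ^ 3)) _ s :=
    (hasDerivAt_const s (1 : ℝ)).div ((hasDerivAt_pow 3 s).const_mul 4) (by positivity)
  have hC := hA.sub (hB.mul (hasDerivAt_log_div h0 h1))
  refine (hC.congr_of_eventuallyEq ?_).congr_deriv ?_
  · filter_upwards [eventually_ne_nhds h0.ne'] with x hx
    simp [phiFun, hx]
  · field_simp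
    ring

lemma phiFun_add_mul_deriv_nonneg {s : ℝ} (h0 : 0 < s) (h1 : s < 1) :
    0 ≤ phiFun s + s * deriv phiFun s := by
  have h : 0 < 1 - s ^ 2 := by nlinarith
  rw [(hasDerivAt_phiFun h0 h1).deriv, phiFun, if_neg h0.ne']
  have hL : 2 * s * (1 - 2 * s ^ 2) / (1 - s ^ 2) ^ 2 ≤ log ((1 + s) / (1 - s)) := by
    refine le_trans ?_ (two_mul_le_log_div h0.le h1)
    rw [div_le_iff₀ (by positivity)]
    have : 0 ≤ 2 * s * s ^ 4 := by positivity
    linarith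
  generalize log ((1 + s) / (1 - s)) = L at hL ⊢
  have : 0 ≤ 1 / (2 * s ^ 3) * (L - 2 * s * (1 - 2 * s ^ 2) / (1 - s ^ 2) ^ 2) :=
    mul_nonneg (by positivity) (sub_nonneg.2 hL)
  convert this using 1
  field_simp
  ring

/-- Generalized eigenvalues of a pencil of matrices of the form `α • 1 + β • u uᵀ`. -/
lemma eq_or_eq_of_mulVec_eq {K n : Type*} [Field K] [Fintype n] [DecidableEq n]
    {p q g h l : K} {u w : n → K} (hw : w ≠ 0)
    (H : (p • 1 + q • Matrix.vecMulVec u u).mulVec w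
      = l • (g • 1 + h • Matrix.vecMulVec u u).mulVec w) :
    p = l * g ∨ p + q * (u ⬝ᵥ u) = l * (g + h * (u ⬝ᵥ u)) := by
  simp only [Matrix.add_mulVec, Matrix.smul_mulVec, Matrix.one_mulVec, Matrix.vecMulVec_mulVec]
    at H
  by_cases ht : u ⬝ᵥ w = 0
  · left
    obtain ⟨i, hi⟩ := Function.ne_iff.1 hw
    have := congrFun H i
    simp only [ht, MulOpposite.op_zero, zero_smul, smul_zero, add_zero, Pi.smul_apply,
      smul_eq_mul, ← mul_assoc] at this
    exact mul_right_cancel₀ hi this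
  · right
    have := congrArg (u ⬝ᵥ ·) H
    simp only [dotProduct_add, dotProduct_smul, smul_eq_mul, op_smul_eq_smul] at this
    refine mul_right_cancel₀ ht ?_
    linear_combination this

lemma isUnit_det_smul_one_add_vecMulVec {K n : Type*} [Field K] [Fintype n] [DecidableEq n]
    {g h : K} {u : n → K} (hg : g ≠ 0) (hgh : g + h * (u ⬝ᵥ u) ≠ 0) :
    IsUnit (g • (1 : Matrix n n K) + h • Matrix.vecMulVec u u).det := by
  rw [isUnit_iff_ne_zero]
  intro hdet
  obtain ⟨w, hw, hw0⟩ := Matrix.exists_mulVec_eq_zero_iff.2 hdet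
  have := eq_or_eq_of_mulVec_eq (l := 0) (g := 0) (h := 0) hw (by rw [hw0, zero_smul])
  simp_all

lemma Matrix.exists_mulVec_eq_smul_mulVec {K n : Type*} [Field K] [Fintype n]
    [DecidableEq n] {A M : Matrix n n K} (hA : IsUnit A.det) {l : K}
    (hl : (A⁻¹ * M).charpoly.IsRoot l) : ∃ w ≠ 0, M.mulVec w = l • A.mulVec w := by
  rw [Polynomial.IsRoot, Matrix.eval_charpoly] at hl
  obtain ⟨w, hw, h⟩ := Matrix.exists_mulVec_eq_zero_iff.2 hl
  rw [Matrix.sub_mulVec, sub_eq_zero] at h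
  refine ⟨w, hw, ?_⟩
  have h2 := congrArg A.mulVec h
  rw [Matrix.mulVec_mulVec, Matrix.mulVec_mulVec, Matrix.mul_nonsing_inv_cancel_left _ _ hA,
    Matrix.scalar_apply, ← Matrix.smul_one_eq_diagonal, Matrix.mul_smul, mul_one,
    Matrix.smul_mulVec] at h2
  exact h2.symm

/-- Real matrix pencils of the form `α • 1 + β • u uᵀ` have real spectrum, explicitly known. -/
lemma eq_ofReal_div_or_of_isRoot_charpoly {n : Type*} [Fintype n] [DecidableEq n]
    {p q g h : ℝ} {u : n → ℝ} (hg : g ≠ 0) (hgh : g + h * (u ⬝ᵥ u) ≠ 0) {l : ℂ}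
    (hl : (((g • 1 + h • Matrix.vecMulVec u u)⁻¹ * (p • 1 + q • Matrix.vecMulVec u u)).map
      (algebraMap ℝ ℂ)).charpoly.IsRoot l) :
    l = ((p / g : ℝ) : ℂ) ∨ l = (((p + q * (u ⬝ᵥ u)) / (g + h * (u ⬝ᵥ u)) : ℝ) : ℂ) := by
  have hmap : ∀ a b : ℝ, (a • 1 + b • Matrix.vecMulVec u u).map (algebraMap ℝ ℂ)
      = (a : ℂ) • 1 + (b : ℂ) • Matrix.vecMulVec (fun i => (u i : ℂ)) (fun i => (u i : ℂ)) := by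
    intro a b
    ext i j
    simp [Matrix.vecMulVec_apply, Matrix.one_apply, apply_ite]
  have hdot : (fun i => (u i : ℂ)) ⬝ᵥ (fun i => (u i : ℂ)) = ((u ⬝ᵥ u : ℝ) : ℂ) := by
    simp [dotProduct]
  have hunit := isUnit_det_smul_one_add_vecMulVec hg hgh
  have hinv : (g • 1 + h • Matrix.vecMulVec u u)⁻¹.map (algebraMap ℝ ℂ)
      = ((g • 1 + h • Matrix.vecMulVec u u).map (algebraMap ℝ ℂ))⁻¹ := by
    refine (Matrix.inv_eq_right_inv ?_).symm
    rw [← Matrix.map_mul, Matrix.mul_nonsing_inv _ hunit]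
    simp
  have hg' : (g : ℂ) ≠ 0 := by exact_mod_cast hg
  have hgh' : (g : ℂ) + h * ((u ⬝ᵥ u : ℝ) : ℂ) ≠ 0 := by exact_mod_cast hgh
  rw [Matrix.map_mul, hinv, hmap, hmap] at hl
  obtain ⟨w, hw, H⟩ := Matrix.exists_mulVec_eq_smul_mulVec
    (isUnit_det_smul_one_add_vecMulVec hg' (by rwa [hdot])) hl
  have := eq_or_eq_of_mulVec_eq hw H
  rw [hdot] at this
  push_cast at this hgh' ⊢
  exact this.imp (fun e => by rw [eq_div_iff hg', e]) (fun e => by rw [eq_div_iff hgh', e])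

lemma gam_pos {v : E3} (hv : ‖v‖ < 1) : 0 < gam v :=
  inv_pos.2 (Real.sqrt_pos.2 (by nlinarith [norm_nonneg v]))

lemma gam_sq_mul {v : E3} (hv : ‖v‖ < 1) : gam v ^ 2 * (1 - ‖v‖ ^ 2) = 1 := by
  have h : 0 < 1 - ‖v‖ ^ 2 := by nlinarith [norm_nonneg v]
  rw [gam, inv_pow, Real.sq_sqrt h.le, inv_mul_cancel₀ h.ne']

lemma rpow_three_halves_eq_gam {v : E3} (hv : ‖v‖ < 1) :
    (1 - ‖v‖ ^ 2) ^ ((3 : ℝ) / 2) = 1 / gam v ^ 3 := by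
  have h : 0 < 1 - ‖v‖ ^ 2 := by nlinarith [norm_nonneg v]
  rw [gam, inv_pow, one_div, inv_inv, Real.sqrt_eq_rpow,
    ← Real.rpow_natCast _ 3, ← Real.rpow_mul h.le]
  norm_num

lemma aMat_eq (e : ℝ) (v : E3) :
    aMat e v = (e ^ 2 / (12 * π) * gam v ^ 4) • 1
      + (e ^ 2 / (12 * π) * (4 * gam v ^ 6)) • Matrix.vecMulVec v v := by
  ext i j
  simp only [aMat, Matrix.of_apply, Matrix.add_apply, Matrix.smul_apply, smul_eq_mul,
    Matrix.vecMulVec_apply, Matrix.one_apply]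
  ring

lemma mMat_eq (me : ℝ) (v : E3) :
    mMat me v = (gam v + 3 * me * phiFun ‖v‖) • 1
      + (gam v ^ 3 + 3 * me * (‖v‖⁻¹ * deriv phiFun ‖v‖)) • Matrix.vecMulVec v v := by
  ext i j
  simp only [mMat, m0Mat, mfMat, Matrix.of_apply, Matrix.add_apply, Matrix.smul_apply,
    smul_eq_mul, Matrix.vecMulVec_apply, Matrix.one_apply]
  ring

lemma EuclideanSpace.dotProduct_self_eq_norm_sq {n : Type*} [Fintype n]
    (v : EuclideanSpace ℝ n) : (v : n → ℝ) ⬝ᵥ v = ‖v‖ ^ 2 := by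
  rw [EuclideanSpace.real_norm_sq_eq]
  simp [dotProduct, sq]

/-- for δ ∈ (0,1] and |v| ≤ 1 − δ, every complex eigenvalue λ of
a(v)⁻¹ m(v) (i.e. every root of the characteristic polynomial of the complexified
matrix) is real and satisfies λ ≥ (3π/e²) γ(v)⁻³ = (3π/e²)(1 − |v|²)^{3/2}. -/
theorem eigenvalues_aInv_m_bounded_below
    (e me δ : ℝ) (he : e ≠ 0) (hme : 0 ≤ me)
    (hδ : δ ∈ Set.Ioc (0 : ℝ) 1) (v : E3) (hv : ‖v‖ ≤ 1 - δ)
    (lam : ℂ)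
    (hlam : (((aMat e v)⁻¹ * mMat me v).map (algebraMap ℝ ℂ)).charpoly.IsRoot lam) :
    lam.im = 0 ∧ (3 * π / e ^ 2) * (1 - ‖v‖ ^ 2) ^ ((3 : ℝ) / 2) ≤ lam.re := by
  have hv1 : ‖v‖ < 1 := by linarith [hδ.1]
  have hs := norm_nonneg v
  have hγ := gam_pos hv1
  have hγ2 := gam_sq_mul hv1
  have hc : 0 < e ^ 2 / (12 * π) := by positivity
  have hpar : 0 ≤ phiFun ‖v‖ + ‖v‖⁻¹ * deriv phiFun ‖v‖ * ‖v‖ ^ 2 := by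
    rcases hs.eq_or_lt with h | h
    · simpa [← h] using phiFun_nonneg le_rfl one_pos
    · convert phiFun_add_mul_deriv_nonneg h hv1 using 2
      field_simp
  have hperp := phiFun_nonneg hs hv1
  rw [aMat_eq, mMat_eq] at hlam
  have hden : e ^ 2 / (12 * π) * gam v ^ 4 + e ^ 2 / (12 * π) * (4 * gam v ^ 6) * ‖v‖ ^ 2
      = e ^ 2 / (12 * π) * gam v ^ 6 * (1 + 3 * ‖v‖ ^ 2) := by
    linear_combination (-(e ^ 2 / (12 * π) * gam v ^ 4)) * hγ2
  have hdot := EuclideanSpace.dotProduct_self_eq_norm_sq v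
  have hpos : 0 < e ^ 2 / (12 * π) * gam v ^ 6 * (1 + 3 * ‖v‖ ^ 2) := by positivity
  have hroot := eq_ofReal_div_or_of_isRoot_charpoly (by positivity)
    (by rw [hdot, hden]; exact hpos.ne') hlam
  rw [hdot, hden] at hroot
  have hlow : 3 * π / e ^ 2 * (1 - ‖v‖ ^ 2) ^ ((3 : ℝ) / 2)
      = 1 / (4 * (e ^ 2 / (12 * π)) * gam v ^ 3) := by
    rw [rpow_three_halves_eq_gam hv1]
    field_simp
    norm_num
  rw [hlow]
  rcases hroot with rfl | rfl
  · refine ⟨Complex.ofReal_im _, ?_⟩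
    rw [Complex.ofReal_re, div_le_div_iff₀ (by positivity) (by positivity)]
    have h1 : 0 ≤ 3 * me * phiFun ‖v‖ * (4 * (e ^ 2 / (12 * π)) * gam v ^ 3) := by positivity
    have h2 : 0 < e ^ 2 / (12 * π) * gam v ^ 4 := by positivity
    linarith
  · refine ⟨Complex.ofReal_im _, ?_⟩
    rw [Complex.ofReal_re, div_le_div_iff₀ (by positivity) hpos]
    have h1 : 0 ≤ 3 * me * (phiFun ‖v‖ + ‖v‖⁻¹ * deriv phiFun ‖v‖ * ‖v‖ ^ 2)
        * (4 * (e ^ 2 / (12 * π)) * gam v ^ 3) := by positivity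
    have h2 : 0 ≤ 3 * (e ^ 2 / (12 * π) * gam v ^ 6) * (1 - ‖v‖ ^ 2) :=
      mul_nonneg (by positivity) (by nlinarith)
    have h3 : gam v * (4 * (e ^ 2 / (12 * π)) * gam v ^ 3)
        + gam v ^ 3 * ‖v‖ ^ 2 * (4 * (e ^ 2 / (12 * π)) * gam v ^ 3)
        = 4 * (e ^ 2 / (12 * π)) * gam v ^ 6 := by
      linear_combination (-(4 * (e ^ 2 / (12 * π)) * gam v ^ 4)) * hγ2
    linarith
end
end

section
/- Let q⁰ ∈ ℝ³, v⁰ ∈ ℝ³ with |v⁰| < 1, and let φ_{v⁰} be the soliton field and π_{v⁰} = −v⁰·∇φ_{v⁰}. Define φ₀(x, t) for t > 0 by Kirchhoff's formula: φ₀(x, t) = (1/(4π t²)) ∫_{|y − x| = t} [ φ_{v⁰}(y − q⁰) + ∇φ_{v⁰}(y − q⁰)·(y − x) + t π_{v⁰}(y − q⁰) ] dσ(y). Then φ₀(x, t) = 0 whenever t > 0 and |x − q⁰| ≤ t − R_ρ. Consequently, for any continuous path q: [0, ∞) → ℝ³ with |q(t) − q⁰| ≤ v̄ t for some v̄ ∈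 [|v⁰|, 1), the force F₀(t) = ∫_{ℝ³} φ₀(x, t) ∇ρ(x − q(t)) d³x vanishes for all t ≥ t₁ = 2R_ρ/(1 − v̄). -/
open Real MeasureTheory Filter
open scoped RealInnerProductSpace

noncomputable section

/-- Fourier transform ρ̂(k) = (2π)^{-3/2} ∫ ρ(x) e^{-i k·x} dx -/
def ftrans (ρ : E3 → ℝ) (k : E3) : ℂ :=
  ((2 * π : ℝ) ^ (-(3 : ℝ) / 2) : ℝ) *
    ∫ x : E3, (ρ x : ℂ) * Complex.exp (-Complex.I * (⟪k, x⟫ : ℝ))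

/-- Fourier transform of the soliton field: φ̂_v(k) = −ρ̂(k)/(|k|² − (v·k)²) -/
def phiHat (ρ : E3 → ℝ) (v k : E3) : ℂ :=
  -ftrans ρ k / ((‖k‖ ^ 2 - ⟪v, k⟫ ^ 2 : ℝ) : ℂ)

/-- the soliton field φ_v, the inverse Fourier transform of φ̂_v -/
def phiSol (ρ : E3 → ℝ) (v x : E3) : ℝ :=
  (((2 * π : ℝ) ^ (-(3 : ℝ) / 2) : ℝ) *
    ∫ k : E3, phiHat ρ v k * Complex.exp (Complex.I * (⟪k, x⟫ : ℝ))).re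

/-- the conjugate soliton field π_v = −v·∇φ_v -/
def piSol (ρ : E3 → ℝ) (v x : E3) : ℝ := -⟪v, gradient (phiSol ρ v) x⟫

/-- the free field φ₀(x,t) given by Kirchhoff's formula with the soliton initial data
(φ_{v⁰}(·−q⁰), π_{v⁰}(·−q⁰)); the surface measure on {|y−x|=t} is the 2-dimensional
Hausdorff measure -/
def phi0 (ρ : E3 → ℝ) (q0 v0 : E3) (x : E3) (t : ℝ) : ℝ :=
  (1 / (4 * π * t ^ 2)) *
    ∫ y in Metric.sphere x t,
      (phiSol ρ v0 (y - q0) + ⟪gradient (phiSol ρ v0) (y - q0), y - x⟫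
        + t * piSol ρ v0 (y - q0)) ∂μH[2]

theorem hasDerivAt_integral_of_continuous {μ : Measure E3} [IsFiniteMeasure μ] {t : ℝ}
    (ht : ∀ᵐ w ∂μ, ‖w‖ ≤ t) {F F' : ℝ → E3 → ℂ} (hF : ∀ θ, Continuous (F θ))
    (hF' : Continuous (Function.uncurry F')) (hd : ∀ θ w, HasDerivAt (F · w) (F' θ w) θ) (θ : ℝ) :
    HasDerivAt (fun θ => ∫ w, F θ w ∂μ) (∫ w, F' θ w ∂μ) θ := by
  obtain ⟨C, hC⟩ := ((isCompact_closedBall θ 1).prod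
    (isCompact_closedBall (0 : E3) t)).exists_bound_of_continuousOn hF'.continuousOn
  obtain ⟨C', hC'⟩ := (isCompact_closedBall (0 : E3) t).exists_bound_of_continuousOn
    (hF θ).continuousOn
  refine (hasDerivAt_integral_of_dominated_loc_of_deriv_le (bound := fun _ => C)
    (Metric.closedBall_mem_nhds θ one_pos)
    (.of_forall fun θ => (hF θ).aestronglyMeasurable) ?_ ?_ ?_ (integrable_const _) ?_).2
  · refine Integrable.of_bound (hF θ).aestronglyMeasurable C' ?_
    filter_upwards [ht] with w hw using hC' w (by simpa using hw)
  · exact (hF'.comp (Continuous.prodMk_right θ)).aestronglyMeasurable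
  · filter_upwards [ht] with w hw θ' hθ' using hC (θ', w) ⟨hθ', by simpa using hw⟩
  · exact .of_forall fun w θ' _ => hd θ' w

theorem integrable_of_continuous_of_ae_bounded {μ : Measure E3} [IsFiniteMeasure μ] {t : ℝ}
    (ht : ∀ᵐ w ∂μ, ‖w‖ ≤ t) {f : E3 → ℂ} (hf : Continuous f) : Integrable f μ := by
  obtain ⟨C, hC⟩ := (isCompact_closedBall (0 : E3) t).exists_bound_of_continuousOn hf.continuousOn
  refine Integrable.of_bound hf.aestronglyMeasurable C ?_
  filter_upwards [ht] with w hw using hC w (by simpa using hw)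

/-- Invariance of a measure under all linear isometries of `ℝ³`. -/
def IsIsometryInvariant (μ : Measure E3) : Prop :=
  ∀ e : E3 ≃ₗᵢ[ℝ] E3, MeasurePreserving e μ μ

theorem integral_cexp_inner_eq_of_norm_eq {μ : Measure E3} (hμ : IsIsometryInvariant μ)
    {F : ℝ → ℂ} {k k' : E3} (h : ‖k‖ = ‖k'‖) :
    ∫ w, F ⟪k, w⟫ ∂μ = ∫ w, F ⟪k', w⟫ ∂μ := by
  set e := (Submodule.span ℝ {k - k'})ᗮ.reflection
  have he : e k = k' := Submodule.reflection_sub h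
  rw [← (hμ e).integral_comp e.toHomeomorph.measurableEmbedding (fun w => F ⟪k', w⟫), ← he]
  simp

section sphericalAverage

variable {μ : Measure E3} [IsFiniteMeasure μ] {t : ℝ}

theorem spherical_average_identity (ht : ∀ᵐ w ∂μ, ‖w‖ = t) (hμ : IsIsometryInvariant μ)
    {a b : E3} (ha : ‖a‖ = 1) (hb : ‖b‖ = 1) (hab : ⟪a, b⟫ = 0) (r : ℝ) :
    ∫ w, (-(r ^ 2 * ⟪b, w⟫ ^ 2 : ℝ) - Complex.I * (r * ⟪a, w⟫ : ℝ)) *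
      Complex.exp (Complex.I * (r * ⟪a, w⟫ : ℝ)) ∂μ = 0 := by
  have ht' : ∀ᵐ w ∂μ, ‖w‖ ≤ t := by filter_upwards [ht] with w hw using hw.le
  set p : ℝ → E3 → ℝ := fun θ w => r * cos θ * ⟪a, w⟫ + r * sin θ * ⟪b, w⟫ with hp
  set p' : ℝ → E3 → ℝ := fun θ w => -(r * sin θ * ⟪a, w⟫) + r * cos θ * ⟪b, w⟫ with hp'
  have hpc : Continuous (Function.uncurry p) := by
    simp only [hp, Function.uncurry_def]; fun_prop
  have hpc' : Continuous (Function.uncurry p') := by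
    simp only [hp', Function.uncurry_def]; fun_prop
  have hdp : ∀ θ w, HasDerivAt (p · w) (p' θ w) θ := fun θ w => by
    refine ((((hasDerivAt_cos θ).const_mul r).mul_const ⟪a, w⟫).add
      (((hasDerivAt_sin θ).const_mul r).mul_const ⟪b, w⟫)).congr_deriv ?_
    simp only [hp']; ring
  have hdp' : ∀ θ w, HasDerivAt (p' · w) (-p θ w) θ := fun θ w => by
    refine ((((hasDerivAt_sin θ).const_mul r).mul_const ⟪a, w⟫).neg.add
      (((hasDerivAt_cos θ).const_mul r).mul_const ⟪b, w⟫)).congr_deriv ?_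
    simp only [hp]; ring
  set F : ℝ → E3 → ℂ := fun θ w => Complex.exp (Complex.I * p θ w) with hFdef
  set F' : ℝ → E3 → ℂ := fun θ w => F θ w * (Complex.I * p' θ w) with hFdef'
  set F'' : ℝ → E3 → ℂ := fun θ w =>
    F' θ w * (Complex.I * p' θ w) + F θ w * (Complex.I * (-p θ w : ℝ)) with hFdef''
  have hFc : Continuous (Function.uncurry F) := by
    have : Continuous fun x : ℝ × E3 => Complex.exp (Complex.I * (Function.uncurry p x : ℝ)) := by
      fun_prop
    exact this
  have hFc' : Continuous (Function.uncurry F') := by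
    have : Continuous fun x : ℝ × E3 =>
      Function.uncurry F x * (Complex.I * (Function.uncurry p' x : ℝ)) := by fun_prop
    exact this
  have hFc'' : Continuous (Function.uncurry F'') := by
    have : Continuous fun x : ℝ × E3 =>
      Function.uncurry F' x * (Complex.I * (Function.uncurry p' x : ℝ)) +
        Function.uncurry F x * (Complex.I * (-Function.uncurry p x : ℝ)) := by fun_prop
    exact this
  have hdF : ∀ θ w, HasDerivAt (F · w) (F' θ w) θ := fun θ w =>
    ((hdp θ w).ofReal_comp.const_mul Complex.I).cexp
  have hdF' : ∀ θ w, HasDerivAt (F' · w) (F'' θ w) θ := fun θ w =>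
    (hdF θ w).mul ((hdp' θ w).ofReal_comp.const_mul Complex.I)
  have h1 := hasDerivAt_integral_of_continuous ht'
    (fun θ => hFc.comp (Continuous.prodMk_right θ)) hFc' hdF
  have h2 := hasDerivAt_integral_of_continuous ht'
    (fun θ => hFc'.comp (Continuous.prodMk_right θ)) hFc'' hdF'
  have hconst : ∀ θ, ∫ w, F θ w ∂μ = ∫ w, F 0 w ∂μ := fun θ => by
    have key := integral_cexp_inner_eq_of_norm_eq hμ
      (F := fun x => Complex.exp (Complex.I * x))
      (k := (r * cos θ) • a + (r * sin θ) • b) (k' := r • a) (by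
        rw [← sq_eq_sq₀ (norm_nonneg _) (norm_nonneg _), @norm_add_sq_real, inner_smul_left,
          inner_smul_right, hab]
        simp only [norm_smul, ha, hb, mul_one, mul_zero, add_zero, norm_eq_abs, sq_abs]
        linear_combination r ^ 2 * sin_sq_add_cos_sq θ)
    simpa [hFdef, hp, inner_add_left, inner_smul_left] using key
  have hz : ∀ θ, ∫ w, F' θ w ∂μ = 0 := fun θ =>
    (h1 θ).unique ((hasDerivAt_const θ _).congr_of_eventuallyEq (.of_forall hconst))
  have hz2 : ∫ w, F'' 0 w ∂μ = 0 :=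
    (h2 0).unique ((hasDerivAt_const 0 _).congr_of_eventuallyEq (.of_forall hz))
  rw [← hz2]
  congr 1 with w
  simp only [hFdef'', hFdef', hFdef, hp, hp', cos_zero, sin_zero]
  push_cast
  ring_nf
  simp only [Complex.I_sq]
  ring

theorem spherical_average_ode (ht : ∀ᵐ w ∂μ, ‖w‖ = t) (hμ : IsIsometryInvariant μ) (r : ℝ) :
    (t * r : ℂ) * ∫ w, Complex.exp (Complex.I * (r * w 2 : ℝ)) ∂μ = μ.real Set.univ * sin (t * r)
    ∧ (∫ w, Complex.exp (Complex.I * (r * w 2 : ℝ)) ∂μ) +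
      ∫ w, Complex.I * (r * w 2 : ℝ) * Complex.exp (Complex.I * (r * w 2 : ℝ)) ∂μ
        = μ.real Set.univ * cos (t * r) := by
  have ht' : ∀ᵐ w ∂μ, ‖w‖ ≤ t := by filter_upwards [ht] with w hw using hw.le
  set e : ℝ → E3 → ℂ := fun r w => Complex.exp (Complex.I * (r * w 2 : ℝ)) with he
  set g0 : ℝ → ℂ := fun r => ∫ w, e r w ∂μ with hg0
  set g1 : ℝ → ℂ := fun r => ∫ w, (Complex.I * (w 2 : ℝ)) * e r w ∂μ with hg1
  set g2 : ℝ → ℂ := fun r => ∫ w, (Complex.I * (w 2 : ℝ)) * ((Complex.I * (w 2 : ℝ)) * e r w) ∂μ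
    with hg2
  have hc : Continuous fun x : ℝ × E3 => e x.1 x.2 := by simp only [he]; fun_prop
  have hcr : ∀ r, Continuous (e r) := fun r => hc.comp (Continuous.prodMk_right r)
  have hde : ∀ r w, HasDerivAt (e · w) ((Complex.I * (w 2 : ℝ)) * e r w) r := fun r w => by
    have := (((hasDerivAt_id r).mul_const (w 2)).ofReal_comp.const_mul Complex.I).cexp
    simp only [id, one_mul] at this
    rw [mul_comm]
    exact this
  have hd0 : ∀ r, HasDerivAt g0 (g1 r) r := hasDerivAt_integral_of_continuous ht'
    hcr (by simp only [Function.uncurry_def]; fun_prop) hde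
  have hd1 : ∀ r, HasDerivAt g1 (g2 r) r := hasDerivAt_integral_of_continuous ht'
    (fun r => by have := hcr r; fun_prop) (by change Continuous fun x : ℝ × E3 => _; fun_prop)
    fun r w => (hde r w).const_mul _
  have hid : ∀ r : ℝ, (r : ℂ) * (r * g2 r + 2 * g1 r + t ^ 2 * r * g0 r) = 0 := fun r => by
    have hI : ∀ f : E3 → ℂ, Continuous f → Integrable f μ := fun f hf =>
      integrable_of_continuous_of_ae_bounded ht' hf
    have i0 := spherical_average_identity ht hμ (a := EuclideanSpace.single 2 1)
      (b := EuclideanSpace.single 0 1) (by simp) (by simp)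
      (by rw [EuclideanSpace.inner_single_left]; simp) r
    have i1 := spherical_average_identity ht hμ (a := EuclideanSpace.single 2 1)
      (b := EuclideanSpace.single 1 1) (by simp) (by simp)
      (by rw [EuclideanSpace.inner_single_left]; simp) r
    simp only [EuclideanSpace.inner_single_left, map_one, one_mul] at i0 i1
    have hce := hcr r
    have := congrArg₂ (· + ·) i0 i1
    simp only [add_zero] at this
    rw [← integral_add (hI _ (by fun_prop)) (hI _ (by fun_prop))] at this
    simp only [hg0, hg1, hg2]
    rw [← neg_eq_zero, ← this]
    rw [← integral_const_mul, ← integral_const_mul, ← integral_const_mul,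
      ← integral_add (hI _ (by fun_prop)) (hI _ (by fun_prop)),
      ← integral_add (hI _ (by fun_prop)) (hI _ (by fun_prop)), ← integral_const_mul,
      ← integral_neg]
    refine integral_congr_ae ?_
    filter_upwards [ht] with w hw
    have h3 : t ^ 2 = w 0 ^ 2 + w 1 ^ 2 + w 2 ^ 2 := by
      rw [← hw, EuclideanSpace.real_norm_sq_eq, Fin.sum_univ_three]
    have h3' : (t : ℂ) ^ 2 = w 0 ^ 2 + w 1 ^ 2 + w 2 ^ 2 := by exact_mod_cast h3
    simp only [he, h3']
    push_cast
    linear_combination (-r ^ 2 * (w 2) ^ 2 *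
      Complex.exp (Complex.I * (r * w 2))) * Complex.I_sq
  have heven : ∀ r, g0 (-r) = g0 r := fun r => by
    have := integral_cexp_inner_eq_of_norm_eq hμ
      (F := fun x => Complex.exp (Complex.I * x))
      (k := (-r) • EuclideanSpace.single 2 1) (k' := r • EuclideanSpace.single 2 1)
      (by simp [norm_smul])
    simpa [hg0, he, inner_smul_left, EuclideanSpace.inner_single_left] using this
  have hg10 : g1 0 = 0 := by
    have h1 : HasDerivAt g0 (-g1 0) 0 := by
      have := HasDerivAt.scomp (0 : ℝ) (h := fun r : ℝ => -r) (h' := -1) (g₁ := g0)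
        (g₁' := g1 0) (by simpa using hd0 0) (hasDerivAt_neg (0 : ℝ))
      have h2 : g0 ∘ (fun r : ℝ => -r) = g0 := funext heven
      rw [h2] at this
      simpa using this
    exact self_eq_neg.1 ((hd0 0).unique h1)
  have hode : ∀ r : ℝ, r * g2 r + 2 * g1 r = - (t ^ 2 * r * g0 r) := fun r => by
    rcases eq_or_ne r 0 with rfl | hr
    · simp [hg10]
    · have := (mul_eq_zero.1 (hid r)).resolve_left (by exact_mod_cast hr)
      linear_combination this
  have hid' : ∀ r : ℝ, HasDerivAt (fun r : ℝ => (r : ℂ)) 1 r := fun r =>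
    (hasDerivAt_id r).ofReal_comp
  have hs : ∀ r : ℝ, HasDerivAt (fun r : ℝ => (sin (t * r) : ℂ)) (t * cos (t * r) : ℝ) r :=
    fun r => by
      have := (((hasDerivAt_id r).const_mul t).sin).ofReal_comp
      simpa [mul_comm] using this
  have hcs : ∀ r : ℝ, HasDerivAt (fun r : ℝ => (cos (t * r) : ℂ)) (-(t * sin (t * r)) : ℝ) r :=
    fun r => by
      have := (((hasDerivAt_id r).const_mul t).cos).ofReal_comp
      simpa [mul_comm] using this
  have hh : ∀ r : ℝ, HasDerivAt (fun r : ℝ => (r : ℂ) * g0 r) (1 * g0 r + r * g1 r) r := fun r =>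
    (hid' r).mul (hd0 r)
  have hh' : ∀ r : ℝ, HasDerivAt (fun r : ℝ => 1 * g0 r + r * g1 r)
      (1 * g1 r + (1 * g1 r + r * g2 r)) r := fun r =>
    ((hd0 r).const_mul 1).add ((hid' r).mul (hd1 r))
  have hA : ∀ r : ℝ, t * ((r : ℂ) * g0 r) * cos (t * r) - (1 * g0 r + r * g1 r) * sin (t * r)
      = 0 := fun r => by
    have hA' : ∀ r, HasDerivAt (fun r : ℝ => t * ((r : ℂ) * g0 r) * cos (t * r)
        - (1 * g0 r + r * g1 r) * sin (t * r)) 0 r := fun r => by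
      refine ((((hh r).const_mul (t : ℂ)).mul (hcs r)).sub ((hh' r).mul (hs r))).congr_deriv ?_
      push_cast
      linear_combination -Complex.sin (t * r) * hode r
    have := is_const_of_deriv_eq_zero (fun r => (hA' r).differentiableAt)
      (fun r => (hA' r).deriv) r 0
    simpa using this
  have hB : ∀ r : ℝ, t * ((r : ℂ) * g0 r) * sin (t * r) + (1 * g0 r + r * g1 r) * cos (t * r)
      = g0 0 := fun r => by
    have hB' : ∀ r, HasDerivAt (fun r : ℝ => t * ((r : ℂ) * g0 r) * sin (t * r)
        + (1 * g0 r + r * g1 r) * cos (t * r)) 0 r := fun r => by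
      refine ((((hh r).const_mul (t : ℂ)).mul (hs r)).add ((hh' r).mul (hcs r))).congr_deriv ?_
      push_cast
      linear_combination Complex.cos (t * r) * hode r
    have := is_const_of_deriv_eq_zero (fun r => (hB' r).differentiableAt)
      (fun r => (hB' r).deriv) r 0
    simpa using this
  have h0 : g0 0 = μ.real Set.univ := by simp [hg0, he]
  have hsc : (sin (t * r) : ℂ) ^ 2 + (cos (t * r) : ℂ) ^ 2 = 1 := by
    exact_mod_cast sin_sq_add_cos_sq (t * r)
  have hg1r : (∫ w, Complex.I * (r * w 2 : ℝ) * e r w ∂μ) = r * g1 r := by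
    simp only [hg1]
    rw [← integral_const_mul]
    congr 1 with w
    push_cast
    ring
  rw [hg1r, ← h0]
  have hA := hA r
  have hB := hB r
  constructor
  · linear_combination (cos (t * r) : ℂ) * hA + (sin (t * r) : ℂ) * hB - t * (r * g0 r) * hsc
  · linear_combination (-sin (t * r) : ℂ) * hA + (cos (t * r) : ℂ) * hB
      - (g0 r + r * g1 r) * hsc

/-- The Fourier transform of a rotation invariant measure on the sphere of radius `t`. -/
theorem integral_cexp_inner_sphere (ht : ∀ᵐ w ∂μ, ‖w‖ = t) (hμ : IsIsometryInvariant μ)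
    (ht0 : 0 < t) {k : E3} (hk : k ≠ 0) :
    ∫ w, Complex.exp (Complex.I * (⟪k, w⟫ : ℝ)) ∂μ
      = μ.real Set.univ * (sin (‖k‖ * t) / (‖k‖ * t) : ℝ) := by
  rw [integral_cexp_inner_eq_of_norm_eq hμ (F := fun x => Complex.exp (Complex.I * x))
    (k' := ‖k‖ • EuclideanSpace.single 2 1) (by simp [norm_smul])]
  have h := (spherical_average_ode ht hμ ‖k‖).1
  simp only [inner_smul_left, EuclideanSpace.inner_single_left, map_one, one_mul,
    RCLike.conj_to_real]
  have h1 : (t * ‖k‖ : ℂ) ≠ 0 := by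
    exact_mod_cast (mul_pos ht0 (norm_pos_iff.2 hk)).ne'
  rw [eq_div_of_mul_eq h1 ((mul_comm _ _).trans h)]
  push_cast
  rw [mul_comm (t : ℂ), mul_div_assoc]

theorem integral_inner_mul_cexp_inner_sphere (ht : ∀ᵐ w ∂μ, ‖w‖ = t)
    (hμ : IsIsometryInvariant μ) (ht0 : 0 < t) {k : E3} (hk : k ≠ 0) :
    ∫ w, Complex.I * (⟪k, w⟫ : ℝ) * Complex.exp (Complex.I * (⟪k, w⟫ : ℝ)) ∂μ
      = μ.real Set.univ * (cos (‖k‖ * t) - sin (‖k‖ * t) / (‖k‖ * t) : ℝ) := by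
  have h0 := integral_cexp_inner_sphere ht hμ ht0 hk
  have hn : ‖k‖ = ‖(‖k‖ • EuclideanSpace.single 2 1 : E3)‖ := by simp [norm_smul]
  rw [integral_cexp_inner_eq_of_norm_eq hμ
    (F := fun x => Complex.exp (Complex.I * x)) hn] at h0
  rw [integral_cexp_inner_eq_of_norm_eq hμ
    (F := fun x => Complex.I * (x : ℝ) * Complex.exp (Complex.I * x)) hn]
  have h := (spherical_average_ode ht hμ ‖k‖).2
  simp only [inner_smul_left, EuclideanSpace.inner_single_left, map_one, one_mul,
    RCLike.conj_to_real] at h0 ⊢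
  rw [h0] at h
  rw [eq_sub_of_add_eq' h]
  push_cast
  rw [mul_comm (t : ℂ)]
  ring

end sphericalAverage

theorem hausdorffMeasure_sphere_lt_top (t : ℝ) (ht : 0 < t) :
    μH[2] (Metric.sphere (0 : E3) t) < ⊤ := by
  set f : (Fin 2 → ℝ) → E3 := fun a =>
    !₂[t * sin (a 0) * cos (a 1), t * sin (a 0) * sin (a 1), t * cos (a 0)] with hf
  have hfc : ContDiff ℝ 1 f := by
    refine (contDiff_euclidean (𝕜 := ℝ)).2 fun i => ?_
    fin_cases i <;> simp [hf] <;> fun_prop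
  set s : Set (Fin 2 → ℝ) := Set.Icc (fun _ => -π) (fun _ => π) with hs
  have hsub : Metric.sphere (0 : E3) t ⊆ f '' s := by
    intro x hx
    have hn : x 0 ^ 2 + x 1 ^ 2 + x 2 ^ 2 = t ^ 2 := by
      rw [← Fin.sum_univ_three (fun i => x i ^ 2), ← EuclideanSpace.real_norm_sq_eq,
        mem_sphere_zero_iff_norm.1 hx]
    set z : ℂ := ⟨x 0, x 1⟩ with hz
    have h2 : |x 2| ≤ t :=
      abs_le_of_sq_le_sq (by nlinarith [sq_nonneg (x 0), sq_nonneg (x 1)]) ht.le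
    have h2' := abs_le.1 h2
    have hcos : t * cos (arccos (x 2 / t)) = x 2 := by
      rw [cos_arccos (by rw [le_div_iff₀ ht]; linarith) (by rw [div_le_iff₀ ht]; linarith)]
      field_simp
    have hsin : t * sin (arccos (x 2 / t)) = ‖z‖ := by
      rw [← sq_eq_sq₀ (mul_nonneg ht.le (sin_nonneg_of_nonneg_of_le_pi (arccos_nonneg _)
        (arccos_le_pi _))) (norm_nonneg _), Complex.sq_norm, Complex.normSq_apply]
      simp only [hz]
      have := sin_sq_add_cos_sq (arccos (x 2 / t))
      rw [← hcos] at hn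
      linear_combination t ^ 2 * this - hn
    refine ⟨![arccos (x 2 / t), z.arg], ⟨?_, ?_⟩, ?_⟩
    · intro i
      fin_cases i
      · simpa using (by linarith [arccos_nonneg (x 2 / t), pi_pos] : -π ≤ arccos (x 2 / t))
      · simpa using (Complex.neg_pi_lt_arg z).le
    · intro i
      fin_cases i
      · simpa using arccos_le_pi _
      · simpa using Complex.arg_le_pi z
    · ext i
      fin_cases i
      · simp [hf, hsin, Complex.norm_mul_cos_arg, hz]
      · simp [hf, hsin, Complex.norm_mul_sin_arg, hz]
      · simpa [hf] using hcos
  obtain ⟨K, hK⟩ := hfc.contDiffOn.exists_lipschitzOnWith one_ne_zero (convex_Icc _ _)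
    (isCompact_Icc (a := fun _ : Fin 2 => -π) (b := fun _ => π))
  refine (measure_mono hsub).trans_lt ((hK.hausdorffMeasure_image_le zero_le_two).trans_lt ?_)
  refine ENNReal.mul_lt_top (by simp) ?_
  have := hausdorffMeasure_pi_real (ι := Fin 2)
  simp only [Fintype.card_fin, Nat.cast_ofNat] at this
  rw [this]
  exact isCompact_Icc.measure_lt_top

theorem hausdorffMeasure_sphere_pos (t : ℝ) (ht : 0 < t) :
    0 < μH[2] (Metric.sphere (0 : E3) t) := by
  set f : E3 → (Fin 2 → ℝ) := fun x => ![x 0, x 1] with hf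
  have hL : LipschitzWith 1 f := by
    refine LipschitzWith.of_dist_le_mul fun x y => ?_
    rw [NNReal.coe_one, one_mul, dist_pi_le_iff dist_nonneg]
    intro i
    have := fun j => (PiLp.norm_apply_le (x - y) j)
    rw [dist_eq_norm, dist_eq_norm]
    fin_cases i
    · simpa [hf] using this 0
    · simpa [hf] using this 1
  have hsub : Set.univ.pi (fun _ => Set.Ioo 0 (t / 2)) ⊆ f '' Metric.sphere (0 : E3) t := by
    intro a ha
    simp only [Set.mem_univ_pi, Set.mem_Ioo] at ha
    have h0 := ha 0
    have h1 := ha 1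
    refine ⟨!₂[a 0, a 1, √(t ^ 2 - a 0 ^ 2 - a 1 ^ 2)], ?_, ?_⟩
    · rw [mem_sphere_zero_iff_norm, ← sq_eq_sq₀ (norm_nonneg _) ht.le,
        EuclideanSpace.real_norm_sq_eq, Fin.sum_univ_three]
      simp only [Matrix.cons_val]
      rw [sq_sqrt (by nlinarith)]
      ring
    · ext i
      fin_cases i <;> simp [hf]
  have := hausdorffMeasure_pi_real (ι := Fin 2)
  simp only [Fintype.card_fin, Nat.cast_ofNat] at this
  have h1 := (measure_mono hsub).trans (hL.hausdorffMeasure_image_le zero_le_two _)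
  rw [this] at h1
  refine lt_of_lt_of_le ?_ (h1.trans (by simp))
  rw [volume_pi_pi]
  simpa using ENNReal.pow_pos (ENNReal.ofReal_pos.2 (half_pos ht)) 2

/-- The surface measure of the sphere of radius `t` about the origin. -/
abbrev sphereMeasure (t : ℝ) : Measure E3 := (μH[2]).restrict (Metric.sphere 0 t)

theorem isFiniteMeasure_sphereMeasure {t : ℝ} (ht : 0 < t) : IsFiniteMeasure (sphereMeasure t) :=
  ⟨by simpa using hausdorffMeasure_sphere_lt_top t ht⟩

theorem sphereMeasure_real_univ_ne_zero {t : ℝ} (ht : 0 < t) :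
    (sphereMeasure t).real Set.univ ≠ 0 := by
  simpa [Measure.real, ENNReal.toReal_eq_zero_iff] using
    ⟨(hausdorffMeasure_sphere_pos t ht).ne', (hausdorffMeasure_sphere_lt_top t ht).ne⟩

theorem ae_norm_eq_sphereMeasure (t : ℝ) : ∀ᵐ w ∂sphereMeasure t, ‖w‖ = t := by
  filter_upwards [ae_restrict_mem Metric.isClosed_sphere.measurableSet] with w hw
  exact mem_sphere_zero_iff_norm.1 hw

theorem isIsometryInvariant_sphereMeasure (t : ℝ) : IsIsometryInvariant (sphereMeasure t) := by
  intro e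
  have h := (e.toIsometryEquiv.measurePreserving_hausdorffMeasure 2).restrict_preimage
    (s := Metric.sphere 0 t) Metric.isClosed_sphere.measurableSet
  have hp : e.toIsometryEquiv ⁻¹' Metric.sphere 0 t = Metric.sphere 0 t := by
    ext w; simp
  rw [hp] at h
  exact h

theorem setIntegral_sphere_eq (f : E3 → ℝ) (x : E3) (t : ℝ) :
    ∫ y in Metric.sphere x t, f y ∂μH[2] = ∫ w, f (x + w) ∂sphereMeasure t := by
  have h := (IsometryEquiv.addLeft x).measurePreserving_hausdorffMeasure 2
  have hp : (IsometryEquiv.addLeft x) ⁻¹' Metric.sphere x t = Metric.sphere 0 t := by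
    ext w; simp
  rw [← h.setIntegral_preimage_emb (IsometryEquiv.addLeft x).toHomeomorph.measurableEmbedding, hp]
  rfl

theorem integral_polar (f : E3 → ℂ) (hf : Integrable f) :
    ∫ k, f k = ∫ ω, ∫ r, f ((r : ℝ) • (ω : E3))
      ∂(Measure.volumeIoiPow 2) ∂(volume : Measure E3).toSphere
    ∧ Integrable (fun p : Metric.sphere (0 : E3) 1 × Set.Ioi (0 : ℝ) => f ((p.2 : ℝ) • (p.1 : E3)))
      ((volume : Measure E3).toSphere.prod (Measure.volumeIoiPow 2)) := by
  have hmp := (volume : Measure E3).measurePreserving_homeomorphUnitSphereProd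
  have hdim : Module.finrank ℝ E3 - 1 = 2 := by simp
  rw [hdim] at hmp
  have hemb := (homeomorphUnitSphereProd E3).measurableEmbedding
  set F := fun p : Metric.sphere (0 : E3) 1 × Set.Ioi (0 : ℝ) => f ((p.2 : ℝ) • (p.1 : E3)) with hF
  have hcomp : F ∘ homeomorphUnitSphereProd E3 = fun x : ({(0 : E3)}ᶜ : Set E3) => f x := by
    ext x
    have : (x : E3) ≠ 0 := x.2
    simp [hF, smul_smul, this]
  have hint : Integrable F ((volume : Measure E3).toSphere.prod (Measure.volumeIoiPow 2)) := by
    rw [← hmp.integrable_comp_emb hemb, hcomp]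
    exact (integrableOn_iff_comap_subtypeVal (measurableSet_singleton (0 : E3)).compl).1
      hf.integrableOn
  refine ⟨?_, hint⟩
  calc ∫ k, f k = ∫ x : ({(0 : E3)}ᶜ : Set E3), f x ∂(volume.comap Subtype.val) := by
        rw [integral_subtype_comap (measurableSet_singleton _).compl f,
          restrict_compl_singleton]
    _ = ∫ p, F p ∂((volume : Measure E3).toSphere.prod (Measure.volumeIoiPow 2)) := by
        rw [← hmp.integral_comp hemb]
        exact integral_congr_ae (.of_forall fun x => (congrFun hcomp x).symm)
    _ = _ := integral_prod _ hint

theorem tendsto_integral_volumeIoiPow_mul_cexp (g : ℝ → ℂ) (n : ℕ) {c : ℝ} (hc : c ≠ 0) :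
    Tendsto (fun s : ℝ => ∫ r, g r * Complex.exp (Complex.I * (s * ((r : ℝ) * c) : ℝ))
      ∂(Measure.volumeIoiPow n)) atTop (nhds 0) := by
  have h := Real.tendsto_integral_exp_smul_cocompact
    (Set.indicator (Set.Ioi 0) fun r : ℝ => (r ^ n : ℝ) • g r)
  have ht : Tendsto (fun s : ℝ => s * (-c / (2 * π))) atTop (cocompact ℝ) :=
    (Homeomorph.mulRight₀ (-c / (2 * π))
      (div_ne_zero (neg_ne_zero.2 hc) two_pi_pos.ne')).isClosedEmbedding.tendsto_cocompact.mono_left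
      atTop_le_cocompact
  refine (h.comp ht).congr fun s => ?_
  simp only [Function.comp, Measure.volumeIoiPow, ENNReal.ofReal]
  rw [integral_withDensity_eq_integral_smul (by fun_prop),
    integral_subtype_comap measurableSet_Ioi fun r : ℝ => Real.toNNReal (r ^ n) •
      (g r * Complex.exp (Complex.I * (s * (r * c) : ℝ))), ← integral_indicator measurableSet_Ioi]
  congr 1 with r
  by_cases hr : r ∈ Set.Ioi (0 : ℝ)
  · simp only [Set.indicator_of_mem hr, Circle.smul_def, Real.fourierChar_apply, NNReal.smul_def,
      Real.coe_toNNReal _ (pow_nonneg (le_of_lt hr) n), smul_eq_mul, Complex.real_smul]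
    rw [mul_left_comm, mul_comm (Complex.exp _)]
    congr 3
    push_cast
    field_simp
  · simp [Set.indicator_of_notMem hr]

/-- A Riemann-Lebesgue lemma for phases which are homogeneous of degree one. -/
theorem tendsto_integral_mul_cexp_homogeneous {f : E3 → ℂ} (hf : Integrable f) {p : E3 → ℝ}
    (hp : Measurable p) (hhom : ∀ (r : ℝ) k, 0 < r → p (r • k) = r * p k)
    (hne : ∀ k, k ≠ 0 → p k ≠ 0) :
    Tendsto (fun s : ℝ => ∫ k, f k * Complex.exp (Complex.I * (s * p k : ℝ))) atTop (nhds 0) := by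
  have hfi : ∀ s : ℝ, Integrable fun k => f k * Complex.exp (Complex.I * (s * p k : ℝ)) := fun s =>
    hf.mul_bdd (c := 1) (by fun_prop)
      (.of_forall fun k => by rw [mul_comm, Complex.norm_exp_ofReal_mul_I])
  have hfp := (integral_polar f hf).2
  simp_rw [fun s => (integral_polar _ (hfi s)).1]
  rw [← integral_zero (Metric.sphere (0 : E3) 1) ℂ (μ := (volume : Measure E3).toSphere)]
  refine tendsto_integral_filter_of_dominated_convergence
    (fun ω => ∫ r, ‖f ((r : ℝ) • (ω : E3))‖ ∂(Measure.volumeIoiPow 2))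
    (.of_forall fun s => (integral_polar _ (hfi s)).2.aestronglyMeasurable.integral_prod_right')
    (.of_forall fun s => .of_forall fun ω => ?_) hfp.norm.integral_prod_left
    (.of_forall fun ω => ?_)
  · refine (norm_integral_le_integral_norm _).trans_eq ?_
    congr 1 with r
    rw [norm_mul, mul_comm Complex.I, Complex.norm_exp_ofReal_mul_I, mul_one]
  · have hω : p ω ≠ 0 := hne _ (by
      have := mem_sphere_zero_iff_norm.1 ω.2
      rw [← norm_ne_zero_iff, this]; exact one_ne_zero)
    refine (tendsto_integral_volumeIoiPow_mul_cexp (fun r => f (r • (ω : E3))) 2 hω).congr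
      fun s => ?_
    congr 1 with r
    rw [hhom _ _ r.2]

theorem hasCompactSupport_of_eq_zero {ρ : E3 → ℝ} {R : ℝ} (hsupp : ∀ x : E3, R ≤ ‖x‖ → ρ x = 0) :
    HasCompactSupport ρ :=
  HasCompactSupport.intro (isCompact_closedBall (0 : E3) R) fun x hx =>
    hsupp x (by simpa using (not_le.1 fun h => hx (by simpa using h)).le)

open scoped FourierTransform SchwartzMap in
theorem exists_schwartz_ftrans {ρ : E3 → ℝ} (hsmooth : ContDiff ℝ (⊤ : ℕ∞) ρ)
    (hc : HasCompactSupport ρ) :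
    ∃ (S : 𝓢(E3, ℂ)) (a b : ℂ), (∀ k, ftrans ρ k = a * S ((2 * π)⁻¹ • k)) ∧
      ∀ x, ∫ k, ftrans ρ k * Complex.exp (Complex.I * (⟪k, x⟫ : ℝ)) = b * ρ x := by
  have hc' : HasCompactSupport fun x => (ρ x : ℂ) := hc.comp_left Complex.ofReal_zero
  set P : 𝓢(E3, ℂ) := hc'.toSchwartzMap (Complex.ofRealCLM.contDiff.comp hsmooth) with hP
  have hPx : ∀ x, P x = ρ x := fun x => rfl
  set a : ℂ := (((2 * π : ℝ) ^ (-(3 : ℝ) / 2) : ℝ) : ℂ)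
  have hA : ∀ k, ftrans ρ k = a * (𝓕 P) ((2 * π)⁻¹ • k) := fun k => by
    rw [SchwartzMap.fourier_coe, Real.fourier_eq']
    simp only [ftrans]
    congr 2 with x
    rw [smul_eq_mul, hPx, mul_comm]
    congr 2
    rw [inner_smul_right, real_inner_comm]
    push_cast
    field_simp
  refine ⟨𝓕 P, a, a * |((2 * π)⁻¹ ^ 3)⁻¹|, hA, fun x => ?_⟩
  have hinv : (ρ x : ℂ) = ∫ ξ, Complex.exp ((2 * π * ⟪ξ, x⟫ : ℝ) * Complex.I) • (𝓕 P) ξ := by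
    rw [← Real.fourierInv_eq', ← SchwartzMap.fourierInv_coe, FourierTransform.fourierInv_fourier_eq,
      hPx]
  have hs := Measure.integral_comp_smul volume
    (fun ξ : E3 => Complex.exp ((2 * π * ⟪ξ, x⟫ : ℝ) * Complex.I) • (𝓕 P) ξ) (2 * π)⁻¹
  rw [← hinv, finrank_euclideanSpace_fin, Complex.real_smul] at hs
  rw [mul_assoc, ← hs, ← integral_const_mul]
  congr 1 with k
  rw [hA, smul_eq_mul, mul_comm (Complex.exp _), ← mul_assoc]
  congr 2
  rw [inner_smul_left]
  simp only [RCLike.conj_to_real]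
  push_cast
  field_simp

theorem le_norm_sq_sub_inner_sq (v k : E3) :
    (1 - ‖v‖ ^ 2) * ‖k‖ ^ 2 ≤ ‖k‖ ^ 2 - ⟪v, k⟫ ^ 2 := by
  have := sq_le_sq.2 ((abs_real_inner_le_norm v k).trans (le_abs_self _))
  nlinarith

theorem norm_sq_sub_inner_sq_pos {v k : E3} (hv : ‖v‖ < 1) (hk : k ≠ 0) :
    0 < ‖k‖ ^ 2 - ⟪v, k⟫ ^ 2 := by
  refine lt_of_lt_of_le ?_ (le_norm_sq_sub_inner_sq v k)
  have : 0 < ‖k‖ := norm_pos_iff.2 hk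
  have : 0 < 1 - ‖v‖ ^ 2 := by nlinarith [norm_nonneg v]
  positivity

theorem continuous_ftrans {ρ : E3 → ℝ} (hsmooth : ContDiff ℝ (⊤ : ℕ∞) ρ)
    (hc : HasCompactSupport ρ) : Continuous (ftrans ρ) := by
  obtain ⟨S, a, b, hA, -⟩ := exists_schwartz_ftrans hsmooth hc
  rw [funext hA]
  have := S.continuous
  fun_prop

theorem exists_norm_ftrans_le {ρ : E3 → ℝ} (hsmooth : ContDiff ℝ (⊤ : ℕ∞) ρ)
    (hc : HasCompactSupport ρ) :
    ∃ C, 0 ≤ C ∧ ∀ k, ‖ftrans ρ k‖ * ((1 + ‖k‖) * (1 + ‖k‖ ^ 2)) ≤ C := by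
  obtain ⟨S, a, b, hA, -⟩ := exists_schwartz_ftrans hsmooth hc
  have key : ∀ n : ℕ, ∃ C, 0 ≤ C ∧ ∀ k, ‖k‖ ^ n * ‖ftrans ρ k‖ ≤ C := fun n => by
    obtain ⟨C, hC0, hC⟩ := S.decay n 0
    refine ⟨‖a‖ * (2 * π) ^ n * C, by positivity, fun k => ?_⟩
    have h := hC ((2 * π)⁻¹ • k)
    rw [norm_iteratedFDeriv_zero, norm_smul, mul_pow, norm_inv, norm_of_nonneg two_pi_pos.le] at h
    rw [hA, norm_mul]
    calc ‖k‖ ^ n * (‖a‖ * ‖S ((2 * π)⁻¹ • k)‖)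
        = ‖a‖ * (2 * π) ^ n * ((2 * π)⁻¹ ^ n * ‖k‖ ^ n * ‖S ((2 * π)⁻¹ • k)‖) := by
          rw [inv_pow]; field_simp
      _ ≤ _ := by gcongr
  choose C hC0 hC using key
  refine ⟨C 0 + C 1 + C 2 + C 3, by linarith [hC0 0, hC0 1, hC0 2, hC0 3], fun k => ?_⟩
  have h0 := hC 0 k
  have h1 := hC 1 k
  have h2 := hC 2 k
  have h3 := hC 3 k
  linarith

theorem measurable_phiHat {ρ : E3 → ℝ} (hsmooth : ContDiff ℝ (⊤ : ℕ∞) ρ) (hc : HasCompactSupport ρ)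
    {v : E3} : Measurable (phiHat ρ v) := by
  have := (continuous_ftrans hsmooth hc).measurable
  unfold phiHat
  fun_prop

theorem integrable_one_add_norm_mul_norm_phiHat {ρ : E3 → ℝ} (hsmooth : ContDiff ℝ (⊤ : ℕ∞) ρ)
    (hc : HasCompactSupport ρ) {v : E3} (hv : ‖v‖ < 1) :
    Integrable fun k => (1 + ‖k‖) * ‖phiHat ρ v k‖ := by
  obtain ⟨C, hC0, hC⟩ := exists_norm_ftrans_le hsmooth hc
  have hv1 : 0 < 1 - ‖v‖ ^ 2 := by nlinarith [norm_nonneg v]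
  have hdom : Integrable fun k : E3 => C / (1 - ‖v‖ ^ 2) * ((‖k‖ ^ 2)⁻¹ * (1 + ‖k‖ ^ 2)⁻¹) := by
    refine Integrable.const_mul ?_ _
    refine (integrable_fun_norm_addHaar (volume : Measure E3)
      (f := fun y : ℝ => (y ^ 2)⁻¹ * (1 + y ^ 2)⁻¹)).2 ?_
    refine (integrable_inv_one_add_sq.integrableOn).congr_fun (fun y hy => ?_) measurableSet_Ioi
    have : y ≠ 0 := (Set.mem_Ioi.1 hy).ne'
    simp only [finrank_euclideanSpace_fin, smul_eq_mul]
    field_simp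
  have hm := measurable_phiHat hsmooth hc (v := v)
  refine hdom.mono' (by fun_prop) (.of_forall fun k => ?_)
  rw [norm_of_nonneg (by positivity)]
  rcases eq_or_ne k 0 with rfl | hk
  · simp [phiHat]
  have hk' : 0 < ‖k‖ := norm_pos_iff.2 hk
  have hD := norm_sq_sub_inner_sq_pos hv hk
  rw [phiHat, norm_div, norm_neg, Complex.norm_real, norm_of_nonneg hD.le]
  have hD' : ‖ftrans ρ k‖ / (‖k‖ ^ 2 - ⟪v, k⟫ ^ 2) ≤
      ‖ftrans ρ k‖ / ((1 - ‖v‖ ^ 2) * ‖k‖ ^ 2) := by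
    gcongr
    exact le_norm_sq_sub_inner_sq v k
  calc _ ≤ (1 + ‖k‖) * (‖ftrans ρ k‖ / ((1 - ‖v‖ ^ 2) * ‖k‖ ^ 2)) := by gcongr
    _ = ‖ftrans ρ k‖ * ((1 + ‖k‖) * (1 + ‖k‖ ^ 2)) / (1 - ‖v‖ ^ 2)
        * ((‖k‖ ^ 2)⁻¹ * (1 + ‖k‖ ^ 2)⁻¹) := by field_simp
    _ ≤ _ := by gcongr; exact hC k

theorem integrable_phiHat_mul {ρ : E3 → ℝ} (hsmooth : ContDiff ℝ (⊤ : ℕ∞) ρ)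
    (hc : HasCompactSupport ρ) {v : E3} (hv : ‖v‖ < 1) {m : E3 → ℂ} (hm : Measurable m) {C : ℝ}
    (hC : ∀ k, ‖m k‖ ≤ C * (1 + ‖k‖)) : Integrable fun k => phiHat ρ v k * m k := by
  refine ((integrable_one_add_norm_mul_norm_phiHat hsmooth hc hv).const_mul C).mono'
    ((measurable_phiHat hsmooth hc).mul hm).aestronglyMeasurable (.of_forall fun k => ?_)
  rw [norm_mul]
  calc _ ≤ ‖phiHat ρ v k‖ * (C * (1 + ‖k‖)) := by gcongr; exact hC k
    _ = _ := by ring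

/-- The Fourier multiplier of the free evolution with initial data `(φ_v, π_v)`. -/
def kirchhoffSymbol (v k : E3) (t : ℝ) : ℂ :=
  cos (‖k‖ * t) - Complex.I * (⟪v, k⟫ * (sin (‖k‖ * t) / ‖k‖) : ℝ)

theorem norm_cexp_I_mul_ofReal (x : ℝ) : ‖Complex.exp (Complex.I * x)‖ = 1 := by
  rw [mul_comm, Complex.norm_exp_ofReal_mul_I]

theorem abs_inner_div_norm_le {v : E3} (hv : ‖v‖ < 1) (k : E3) : |⟪v, k⟫ / ‖k‖| ≤ 1 := by
  rw [abs_div, abs_norm]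
  refine div_le_one_of_le₀ ((abs_real_inner_le_norm v k).trans ?_) (norm_nonneg _)
  exact mul_le_of_le_one_left (norm_nonneg _) hv.le

theorem integrable_ftrans {ρ : E3 → ℝ} (hsmooth : ContDiff ℝ (⊤ : ℕ∞) ρ)
    (hc : HasCompactSupport ρ) : Integrable (ftrans ρ) := by
  obtain ⟨S, a, b, hA, -⟩ := exists_schwartz_ftrans hsmooth hc
  rw [funext hA]
  exact (S.integrable.comp_smul (inv_ne_zero two_pi_pos.ne')).const_mul a

/-- If the spherical mean of `ρ` over the sphere of radius `τ` about `z` vanishes trivially, so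
does its Fourier representation. -/
theorem integral_ftrans_mul_sin_eq_zero {ρ : E3 → ℝ} (hsmooth : ContDiff ℝ (⊤ : ℕ∞) ρ)
    (hc : HasCompactSupport ρ) {z : E3} {τ : ℝ} (hτ : 0 < τ)
    (hz : ∀ w : E3, ‖w‖ = τ → ρ (z + w) = 0) :
    ∫ k, ftrans ρ k * (Complex.exp (Complex.I * (⟪k, z⟫ : ℝ)) * (sin (‖k‖ * τ) / ‖k‖ : ℝ)) = 0 := by
  obtain ⟨-, -, b, -, hb⟩ := exists_schwartz_ftrans hsmooth hc
  have := isFiniteMeasure_sphereMeasure hτ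
  have hint : Integrable (Function.uncurry fun (w k : E3) =>
      ftrans ρ k * Complex.exp (Complex.I * (⟪k, z + w⟫ : ℝ)))
      ((sphereMeasure τ).prod volume) := by
    refine Integrable.mul_bdd (c := 1) ((integrable_ftrans hsmooth hc).comp_snd _) ?_
      (.of_forall fun p => (norm_cexp_I_mul_ofReal _).le)
    exact Continuous.aestronglyMeasurable (by fun_prop)
  have hswap := integral_integral_swap hint
  have h0 : ∫ w, ∫ k, ftrans ρ k * Complex.exp (Complex.I * (⟪k, z + w⟫ : ℝ))
      ∂volume ∂sphereMeasure τ = 0 := by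
    rw [← integral_zero E3 ℂ (μ := sphereMeasure τ)]
    refine integral_congr_ae ?_
    filter_upwards [ae_norm_eq_sphereMeasure τ] with w hw
    rw [hb, hz w hw]
    simp
  rw [h0] at hswap
  have h1 : ∫ k, ∫ w, ftrans ρ k * Complex.exp (Complex.I * (⟪k, z + w⟫ : ℝ)) ∂sphereMeasure τ =
      ∫ k, ((sphereMeasure τ).real Set.univ / τ : ℂ) *
        (ftrans ρ k * (Complex.exp (Complex.I * (⟪k, z⟫ : ℝ)) * (sin (‖k‖ * τ) / ‖k‖ : ℝ))) := by
    refine integral_congr_ae ?_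
    filter_upwards [compl_mem_ae_iff.2 (measure_singleton (0 : E3))] with k hk
    have h2 := integral_cexp_inner_sphere (ae_norm_eq_sphereMeasure τ)
      (isIsometryInvariant_sphereMeasure τ) hτ (k := k) hk
    simp only [inner_add_right, Complex.ofReal_add, mul_add, Complex.exp_add, integral_const_mul]
    rw [h2]
    push_cast
    field_simp
  rw [h1, integral_const_mul, eq_comm, mul_eq_zero] at hswap
  refine hswap.resolve_left (div_ne_zero ?_ ?_)
  · exact_mod_cast sphereMeasure_real_univ_ne_zero hτ
  · exact_mod_cast hτ.ne'

theorem hasFDerivAt_integral_phiHat_mul_cexp {ρ : E3 → ℝ} (hsmooth : ContDiff ℝ (⊤ : ℕ∞) ρ)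
    (hc : HasCompactSupport ρ) {v : E3} (hv : ‖v‖ < 1) (z : E3) :
    Integrable (fun k => (phiHat ρ v k * Complex.exp (Complex.I * (⟪k, z⟫ : ℝ)) * Complex.I) •
        (Complex.ofRealCLM ∘L innerSL ℝ k)) ∧
    HasFDerivAt (fun z => ∫ k, phiHat ρ v k * Complex.exp (Complex.I * (⟪k, z⟫ : ℝ)))
      (∫ k, (phiHat ρ v k * Complex.exp (Complex.I * (⟪k, z⟫ : ℝ)) * Complex.I) •
        (Complex.ofRealCLM ∘L innerSL ℝ k)) z := by
  have hm := measurable_phiHat hsmooth hc (v := v)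
  have hmeas : AEStronglyMeasurable (fun k =>
      (phiHat ρ v k * Complex.exp (Complex.I * (⟪k, z⟫ : ℝ)) * Complex.I) •
        (Complex.ofRealCLM ∘L innerSL ℝ k)) volume := by
    have h1 : Continuous fun k : E3 => (Complex.ofRealCLM ∘L innerSL ℝ k) := by fun_prop
    exact AEStronglyMeasurable.smul (by fun_prop : Measurable fun k =>
      phiHat ρ v k * Complex.exp (Complex.I * (⟪k, z⟫ : ℝ)) * Complex.I).aestronglyMeasurable
      h1.aestronglyMeasurable
  have hbound : ∀ k z : E3,
      ‖(phiHat ρ v k * Complex.exp (Complex.I * (⟪k, z⟫ : ℝ)) * Complex.I) •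
        (Complex.ofRealCLM ∘L innerSL ℝ k)‖ ≤ (1 + ‖k‖) * ‖phiHat ρ v k‖ := fun k z => by
    rw [norm_smul, norm_mul, norm_mul, norm_cexp_I_mul_ofReal, Complex.norm_I, mul_one, mul_one,
      mul_comm]
    gcongr
    refine (ContinuousLinearMap.opNorm_comp_le _ _).trans ?_
    rw [Complex.ofRealCLM_norm, one_mul, innerSL_apply_norm]
    linarith
  have hdom := integrable_one_add_norm_mul_norm_phiHat hsmooth hc hv
  refine ⟨hdom.mono' hmeas (.of_forall fun k => hbound k z), ?_⟩
  refine hasFDerivAt_integral_of_dominated_of_fderiv_le (Filter.univ_mem)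
    (.of_forall fun z => (by fun_prop : Measurable fun k =>
      phiHat ρ v k * Complex.exp (Complex.I * (⟪k, z⟫ : ℝ))).aestronglyMeasurable) ?_ hmeas
    (.of_forall fun k z _ => hbound k z) hdom (.of_forall fun k z _ => ?_)
  · refine integrable_phiHat_mul hsmooth hc hv (C := 1) (by fun_prop) fun k => ?_
    rw [norm_cexp_I_mul_ofReal]
    linarith [norm_nonneg k]
  · have h1 : HasFDerivAt (fun z => ((⟪k, z⟫ : ℝ) : ℂ)) (Complex.ofRealCLM ∘L innerSL ℝ k) z :=
      (Complex.ofRealCLM ∘L innerSL ℝ k).hasFDerivAt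
    refine ((h1.const_mul Complex.I).cexp.const_mul (phiHat ρ v k)).congr_fderiv ?_
    rw [smul_smul, smul_smul, mul_assoc]

theorem inner_gradient_phiSol {ρ : E3 → ℝ} (hsmooth : ContDiff ℝ (⊤ : ℕ∞) ρ)
    (hc : HasCompactSupport ρ) {v : E3} (hv : ‖v‖ < 1) (z w : E3) :
    ⟪gradient (phiSol ρ v) z, w⟫ = ((((2 * π : ℝ) ^ (-(3 : ℝ) / 2) : ℝ) : ℂ) *
      ∫ k, phiHat ρ v k * (Complex.I * (⟪k, w⟫ : ℝ) *
        Complex.exp (Complex.I * (⟪k, z⟫ : ℝ)))).re := by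
  obtain ⟨hi, hd⟩ := hasFDerivAt_integral_phiHat_mul_cexp hsmooth hc hv z
  have hd' : HasFDerivAt (phiSol ρ v) _ z := Complex.reCLM.hasFDerivAt.comp z
    (hd.const_mul (((2 * π : ℝ) ^ (-(3 : ℝ) / 2) : ℝ) : ℂ))
  rw [gradient, InnerProductSpace.toDual_symm_apply, hd'.fderiv]
  simp only [ContinuousLinearMap.comp_apply, smul_apply, Complex.reCLM_apply,
    smul_eq_mul]
  rw [ContinuousLinearMap.integral_apply hi]
  congr 3 with k
  simp only [smul_apply, ContinuousLinearMap.comp_apply, smul_eq_mul,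
    Complex.ofRealCLM_apply, innerSL_apply_apply]
  ring

theorem kirchhoff_integrand_eq {ρ : E3 → ℝ} (hsmooth : ContDiff ℝ (⊤ : ℕ∞) ρ)
    (hc : HasCompactSupport ρ) {v : E3} (hv : ‖v‖ < 1) (z w : E3) (t : ℝ) :
    phiSol ρ v z + ⟪gradient (phiSol ρ v) z, w⟫ + t * piSol ρ v z =
      ((((2 * π : ℝ) ^ (-(3 : ℝ) / 2) : ℝ) : ℂ) * ∫ k, phiHat ρ v k *
        ((1 + Complex.I * (⟪k, w⟫ : ℝ) - Complex.I * (t * ⟪v, k⟫ : ℝ)) *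
          Complex.exp (Complex.I * (⟪k, z⟫ : ℝ)))).re := by
  have hI : ∀ w : E3, Integrable fun k => phiHat ρ v k *
      (Complex.I * (⟪k, w⟫ : ℝ) * Complex.exp (Complex.I * (⟪k, z⟫ : ℝ))) := fun w => by
    refine integrable_phiHat_mul hsmooth hc hv (C := ‖w‖) (by fun_prop) fun k => ?_
    rw [norm_mul, norm_cexp_I_mul_ofReal, norm_mul, Complex.norm_I, Complex.norm_real, one_mul,
      mul_one]
    refine (norm_inner_le_norm k w).trans ?_
    nlinarith [norm_nonneg w]
  have hI0 : Integrable fun k => phiHat ρ v k * Complex.exp (Complex.I * (⟪k, z⟫ : ℝ)) := by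
    refine integrable_phiHat_mul hsmooth hc hv (C := 1) (by fun_prop) fun k => ?_
    rw [norm_cexp_I_mul_ofReal]
    linarith [norm_nonneg k]
  rw [piSol, real_inner_comm (gradient (phiSol ρ v) z) v, inner_gradient_phiSol hsmooth hc hv,
    inner_gradient_phiSol hsmooth hc hv, phiSol, mul_neg, ← Complex.re_ofReal_mul, ← sub_eq_add_neg,
    ← Complex.add_re, ← Complex.sub_re, mul_left_comm, ← mul_add, ← mul_sub, ← integral_const_mul,
    ← integral_add hI0 (hI w), ← integral_sub (hI0.fun_add (hI w)) ((hI v).const_mul _)]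
  congr 3 with k
  rw [real_inner_comm k v]
  push_cast
  ring

theorem phi0_eq {ρ : E3 → ℝ} (hsmooth : ContDiff ℝ (⊤ : ℕ∞) ρ) (hc : HasCompactSupport ρ) {v : E3}
    (hv : ‖v‖ < 1) (q0 x : E3) {t : ℝ} (ht : 0 < t) :
    phi0 ρ q0 v x t = (1 / (4 * π * t ^ 2)) * ((((2 * π : ℝ) ^ (-(3 : ℝ) / 2) : ℝ) : ℂ) *
      ((sphereMeasure t).real Set.univ * ∫ k, phiHat ρ v k *
        (Complex.exp (Complex.I * (⟪k, x - q0⟫ : ℝ)) * kirchhoffSymbol v k t))).re := by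
  have := isFiniteMeasure_sphereMeasure ht
  have hm := measurable_phiHat hsmooth hc (v := v)
  set z := x - q0 with hz
  set G : E3 → E3 → ℂ := fun w k => phiHat ρ v k *
    ((1 + Complex.I * (⟪k, w⟫ : ℝ) - Complex.I * (t * ⟪v, k⟫ : ℝ)) *
      Complex.exp (Complex.I * (⟪k, z + w⟫ : ℝ))) with hG
  have hint : Integrable (Function.uncurry G) ((sphereMeasure t).prod volume) := by
    have hdom := ((integrable_one_add_norm_mul_norm_phiHat hsmooth hc hv).const_mul
      (1 + 2 * t)).comp_snd (sphereMeasure t)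
    refine hdom.mono' (Measurable.aestronglyMeasurable ?_) ?_
    · simp only [hG, Function.uncurry_def]
      fun_prop
    · have h1 : ∀ᵐ p ∂((sphereMeasure t).prod (volume : Measure E3)), ‖p.1‖ = t :=
        Measure.quasiMeasurePreserving_fst.ae (ae_norm_eq_sphereMeasure t)
      filter_upwards [h1] with p hp
      simp only [hG, Function.uncurry_def]
      rw [norm_mul, norm_mul, norm_cexp_I_mul_ofReal, mul_one, mul_comm, ← mul_assoc]
      gcongr
      refine (norm_sub_le _ _).trans ((add_le_add_left (norm_add_le _ _) _).trans ?_)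
      rw [norm_mul, norm_mul, Complex.norm_I, Complex.norm_real, Complex.norm_real, norm_one,
        norm_mul, norm_of_nonneg ht.le, one_mul, one_mul]
      have h2 := norm_inner_le_norm (𝕜 := ℝ) p.2 p.1
      have h3 := (norm_inner_le_norm (𝕜 := ℝ) v p.2).trans
        (mul_le_of_le_one_left (norm_nonneg _) hv.le)
      rw [hp] at h2
      nlinarith [norm_nonneg p.2, mul_le_mul_of_nonneg_left h3 ht.le]
  rw [phi0, setIntegral_sphere_eq]
  congr 1
  have h1 : ∀ w : E3, phiSol ρ v (x + w - q0) + ⟪gradient (phiSol ρ v) (x + w - q0), x + w - x⟫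
      + t * piSol ρ v (x + w - q0) =
      ((((2 * π : ℝ) ^ (-(3 : ℝ) / 2) : ℝ) : ℂ) * ∫ k, G w k).re := fun w => by
    rw [kirchhoff_integrand_eq hsmooth hc hv, add_sub_cancel_left, add_sub_right_comm]
  simp_rw [h1]
  have hi : Integrable (fun w => (((2 * π : ℝ) ^ (-(3 : ℝ) / 2) : ℝ) : ℂ) * ∫ k, G w k)
      (sphereMeasure t) := hint.integral_prod_left.const_mul _
  have hre := Complex.reCLM.integral_comp_comm (𝕜 := ℝ) hi
  simp only [Complex.reCLM_apply] at hre
  rw [hre, integral_const_mul, integral_integral_swap hint,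
    ← integral_const_mul ((sphereMeasure t).real Set.univ : ℂ)]
  congr 2
  refine integral_congr_ae ?_
  filter_upwards [compl_mem_ae_iff.2 (measure_singleton (0 : E3))] with k hk
  have i0 := integral_cexp_inner_sphere (ae_norm_eq_sphereMeasure t)
    (isIsometryInvariant_sphereMeasure t) ht (k := k) hk
  have i1 := integral_inner_mul_cexp_inner_sphere (ae_norm_eq_sphereMeasure t)
    (isIsometryInvariant_sphereMeasure t) ht (k := k) hk
  have hle : ∀ᵐ w ∂sphereMeasure t, ‖w‖ ≤ t := by
    filter_upwards [ae_norm_eq_sphereMeasure t] with w hw using hw.le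
  have hGk : ∀ w, G w k = phiHat ρ v k * Complex.exp (Complex.I * (⟪k, z⟫ : ℝ)) *
      ((1 - Complex.I * (t * ⟪v, k⟫ : ℝ)) * Complex.exp (Complex.I * (⟪k, w⟫ : ℝ)) +
        Complex.I * (⟪k, w⟫ : ℝ) * Complex.exp (Complex.I * (⟪k, w⟫ : ℝ))) := fun w => by
    simp only [hG, inner_add_right, Complex.ofReal_add, mul_add, Complex.exp_add]
    ring
  simp_rw [hGk]
  rw [integral_const_mul, integral_add
    (integrable_of_continuous_of_ae_bounded hle (by fun_prop))
    (integrable_of_continuous_of_ae_bounded hle (by fun_prop)), integral_const_mul, i0, i1,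
    kirchhoffSymbol]
  have hk' : (‖k‖ : ℂ) ≠ 0 := by exact_mod_cast norm_ne_zero_iff.2 hk
  have ht' : (t : ℂ) ≠ 0 := by exact_mod_cast ht.ne'
  push_cast
  field_simp
  ring

theorem abs_norm_sq_sub_inner_sq_le {v : E3} (hv : ‖v‖ < 1)
    (k : E3) : |‖k‖ ^ 2 - ⟪v, k⟫ ^ 2| ≤ ‖k‖ ^ 2 := by
  rw [abs_le]
  have h1 := abs_real_inner_le_norm v k
  have h2 : |⟪v, k⟫| ≤ ‖k‖ := h1.trans (mul_le_of_le_one_left (norm_nonneg _) hv.le)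
  have h3 := sq_le_sq' (abs_le.1 h2).1 (abs_le.1 h2).2
  constructor <;> nlinarith [sq_nonneg ⟪v, k⟫, sq_nonneg ‖k‖]

theorem hasDerivAt_cexp_mul_kirchhoffSymbol (v z k : E3) (t s : ℝ) :
    HasDerivAt (fun s : ℝ => Complex.exp (Complex.I * (⟪k, z + s • v⟫ : ℝ)) *
        kirchhoffSymbol v k (t + s))
      (-(Complex.exp (Complex.I * (⟪k, z + s • v⟫ : ℝ)) *
        ((‖k‖ ^ 2 - ⟪v, k⟫ ^ 2) * (sin (‖k‖ * (t + s)) / ‖k‖) : ℝ))) s := by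
  rcases eq_or_ne k 0 with rfl | hk
  · simpa [kirchhoffSymbol] using hasDerivAt_const s (1 : ℂ)
  have hk' : (‖k‖ : ℂ) ≠ 0 := by exact_mod_cast norm_ne_zero_iff.2 hk
  have h1 : HasDerivAt (fun s : ℝ => ⟪k, z + s • v⟫) ⟪v, k⟫ s := by
    have := ((hasDerivAt_id s).mul_const ⟪k, v⟫).const_add ⟪k, z⟫
    simpa [inner_add_right, inner_smul_right, real_inner_comm k v] using this
  have h2 : HasDerivAt (fun s : ℝ => ‖k‖ * (t + s)) ‖k‖ s := by
    simpa using ((hasDerivAt_id s).const_add t).const_mul ‖k‖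
  have h3 : HasDerivAt (fun s => kirchhoffSymbol v k (t + s))
      (((-sin (‖k‖ * (t + s)) * ‖k‖ : ℝ) : ℂ) -
        Complex.I * (⟪v, k⟫ * (cos (‖k‖ * (t + s)) * ‖k‖ / ‖k‖) : ℝ)) s :=
    h2.cos.ofReal_comp.sub
      ((((h2.sin.div_const ‖k‖).const_mul ⟪v, k⟫).ofReal_comp).const_mul Complex.I)
  refine ((h1.ofReal_comp.const_mul Complex.I).cexp.mul h3).congr_deriv ?_
  rw [kirchhoffSymbol]
  push_cast
  field_simp
  linear_combination (- ((⟪v, k⟫ : ℝ) : ℂ) ^ 2 * Complex.sin (‖k‖ * (t + s))) * Complex.I_sq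

theorem norm_kirchhoffSymbol_le {v : E3} (hv : ‖v‖ < 1)
    (k : E3) (t : ℝ) : ‖kirchhoffSymbol v k t‖ ≤ 2 := by
  refine (norm_sub_le _ _).trans ?_
  rw [norm_mul, Complex.norm_I, one_mul, Complex.norm_real, Complex.norm_real,
    mul_div_left_comm, norm_mul, norm_eq_abs, norm_eq_abs, norm_eq_abs]
  have h1 := abs_inner_div_norm_le hv k
  have h2 := abs_sin_le_one (‖k‖ * t)
  have h3 := abs_cos_le_one (‖k‖ * t)
  nlinarith [abs_nonneg (sin (‖k‖ * t)), abs_nonneg (⟪v, k⟫ / ‖k‖)]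

theorem hasDerivAt_integral_phiHat_mul_kirchhoffSymbol {ρ : E3 → ℝ}
    (hsmooth : ContDiff ℝ (⊤ : ℕ∞) ρ) (hc : HasCompactSupport ρ) {v : E3} (hv : ‖v‖ < 1)
    (z : E3) (t s : ℝ) :
    HasDerivAt (fun s : ℝ => ∫ k, phiHat ρ v k *
        (Complex.exp (Complex.I * (⟪k, z + s • v⟫ : ℝ)) * kirchhoffSymbol v k (t + s)))
      (∫ k, ftrans ρ k * (Complex.exp (Complex.I * (⟪k, z + s • v⟫ : ℝ)) *
        (sin (‖k‖ * (t + s)) / ‖k‖ : ℝ))) s := by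
  have hm := measurable_phiHat hsmooth hc (v := v)
  have hms : ∀ s : ℝ, Measurable fun k : E3 =>
      Complex.exp (Complex.I * (⟪k, z + s • v⟫ : ℝ)) * kirchhoffSymbol v k (t + s) := fun s => by
    unfold kirchhoffSymbol
    fun_prop
  have hder := hasDerivAt_integral_of_dominated_loc_of_deriv_le (μ := (volume : Measure E3))
    (F := fun (s : ℝ) k => phiHat ρ v k *
      (Complex.exp (Complex.I * (⟪k, z + s • v⟫ : ℝ)) * kirchhoffSymbol v k (t + s)))
    (F' := fun (s : ℝ) k => phiHat ρ v k * -(Complex.exp (Complex.I * (⟪k, z + s • v⟫ : ℝ)) *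
        ((‖k‖ ^ 2 - ⟪v, k⟫ ^ 2) * (sin (‖k‖ * (t + s)) / ‖k‖) : ℝ)))
    (bound := fun k => (1 + ‖k‖) * ‖phiHat ρ v k‖) (x₀ := s) Filter.univ_mem
    (.of_forall fun s => (hm.mul (hms s)).aestronglyMeasurable)
    (integrable_phiHat_mul hsmooth hc hv (C := 2) (hms s) fun k => ?_)
    (by fun_prop : Measurable fun k : E3 =>
      phiHat ρ v k * -(Complex.exp (Complex.I * (⟪k, z + s • v⟫ : ℝ)) *
        ((‖k‖ ^ 2 - ⟪v, k⟫ ^ 2) * (sin (‖k‖ * (t + s)) / ‖k‖) : ℝ))).aestronglyMeasurable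
    (.of_forall fun k s _ => ?_)
    (integrable_one_add_norm_mul_norm_phiHat hsmooth hc hv)
    (.of_forall fun k s _ => (hasDerivAt_cexp_mul_kirchhoffSymbol v z k t s).const_mul _)
  · refine hder.2.congr_deriv (integral_congr_ae ?_)
    filter_upwards [compl_mem_ae_iff.2 (measure_singleton (0 : E3))] with k hk
    have hD : ((‖k‖ ^ 2 - ⟪v, k⟫ ^ 2 : ℝ) : ℂ) ≠ 0 := by
      exact_mod_cast (norm_sq_sub_inner_sq_pos hv hk).ne'
    rw [Complex.ofReal_mul, phiHat]
    generalize ((‖k‖ ^ 2 - ⟪v, k⟫ ^ 2 : ℝ) : ℂ) = D at hD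
    field_simp
  · rw [norm_mul, norm_cexp_I_mul_ofReal, one_mul]
    linarith [norm_kirchhoffSymbol_le hv k (t + s), norm_nonneg k]
  · rw [norm_mul, mul_comm, norm_neg, norm_mul, norm_cexp_I_mul_ofReal, one_mul]
    gcongr
    rw [Complex.norm_real, norm_mul, norm_div, norm_norm, norm_eq_abs, norm_eq_abs]
    have h1 := abs_norm_sq_sub_inner_sq_le hv k
    calc |‖k‖ ^ 2 - ⟪v, k⟫ ^ 2| * (|sin (‖k‖ * (t + s))| / ‖k‖) ≤ ‖k‖ ^ 2 * (1 / ‖k‖) := by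
          gcongr
          exact abs_sin_le_one _
      _ ≤ 1 + ‖k‖ := by
          rcases eq_or_ne ‖k‖ 0 with h | h
          · simp [h]
          · rw [sq, mul_assoc, mul_one_div_cancel h]; linarith

theorem tendsto_integral_phiHat_mul_kirchhoffSymbol {ρ : E3 → ℝ} (hsmooth : ContDiff ℝ (⊤ : ℕ∞) ρ)
    (hc : HasCompactSupport ρ) {v : E3} (hv : ‖v‖ < 1) (z : E3) (t : ℝ) :
    Tendsto (fun s : ℝ => ∫ k, phiHat ρ v k *
        (Complex.exp (Complex.I * (⟪k, z + s • v⟫ : ℝ)) * kirchhoffSymbol v k (t + s)))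
      atTop (nhds 0) := by
  have hlim : ∀ ε : ℝ, |ε| = 1 →
      Integrable (fun k => phiHat ρ v k * (Complex.exp (Complex.I * (⟪k, z⟫ : ℝ)) *
        Complex.exp (Complex.I * (ε * ‖k‖ * t : ℝ)) *
          ((1 - ε * (⟪v, k⟫ / ‖k‖)) / 2 : ℝ))) ∧
      Tendsto (fun s : ℝ => ∫ k, phiHat ρ v k * (Complex.exp (Complex.I * (⟪k, z⟫ : ℝ)) *
        Complex.exp (Complex.I * (ε * ‖k‖ * t : ℝ)) *
          ((1 - ε * (⟪v, k⟫ / ‖k‖)) / 2 : ℝ)) *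
            Complex.exp (Complex.I * (s * (⟪k, v⟫ + ε * ‖k‖) : ℝ))) atTop (nhds 0) := by
    intro ε hε
    have hint : Integrable (fun k => phiHat ρ v k * (Complex.exp (Complex.I * (⟪k, z⟫ : ℝ)) *
        Complex.exp (Complex.I * (ε * ‖k‖ * t : ℝ)) *
          ((1 - ε * (⟪v, k⟫ / ‖k‖)) / 2 : ℝ))) := by
      refine integrable_phiHat_mul hsmooth hc hv (C := 1) (by fun_prop) fun k => ?_
      rw [norm_mul, norm_mul, norm_cexp_I_mul_ofReal, norm_cexp_I_mul_ofReal, one_mul, one_mul,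
        Complex.norm_real, norm_eq_abs, one_mul]
      have h1 : |ε * (⟪v, k⟫ / ‖k‖)| ≤ 1 := by
        rw [abs_mul, hε, one_mul]
        exact abs_inner_div_norm_le hv k
      rw [abs_le] at h1 ⊢
      constructor <;> linarith [norm_nonneg k]
    refine ⟨hint, tendsto_integral_mul_cexp_homogeneous hint
      (p := fun k => ⟪k, v⟫ + ε * ‖k‖) (by fun_prop) (fun r k hr => ?_) fun k hk h0 => ?_⟩
    · rw [inner_smul_left, norm_smul, norm_of_nonneg hr.le, RCLike.conj_to_real]
      ring
    · have h1 := abs_real_inner_le_norm k v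
      rw [eq_neg_of_add_eq_zero_left h0, abs_neg, abs_mul, hε, one_mul, abs_norm] at h1
      nlinarith [norm_pos_iff.2 hk]
  obtain ⟨hi1, hl1⟩ := hlim 1 abs_one
  obtain ⟨hi2, hl2⟩ := hlim (-1) (by simp)
  have hsum := hl1.add hl2
  rw [add_zero] at hsum
  refine hsum.congr fun s => ?_
  have hb : ∀ ε : ℝ, AEStronglyMeasurable (fun k : E3 =>
      Complex.exp (Complex.I * (s * (⟪k, v⟫ + ε * ‖k‖) : ℝ))) volume := fun ε =>
    Continuous.aestronglyMeasurable (by fun_prop)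
  rw [← integral_add
    (hi1.mul_bdd (c := 1) (hb 1) (.of_forall fun k => (norm_cexp_I_mul_ofReal _).le))
    (hi2.mul_bdd (c := 1) (hb (-1)) (.of_forall fun k => (norm_cexp_I_mul_ofReal _).le))]
  congr 1 with k
  have hcos : Complex.cos (‖k‖ * (t + s) : ℝ) = (Complex.exp (Complex.I * (‖k‖ * (t + s) : ℝ)) +
      Complex.exp (-(Complex.I * (‖k‖ * (t + s) : ℝ)))) / 2 := by
    rw [Complex.cos]; ring_nf
  have hsin : Complex.sin (‖k‖ * (t + s) : ℝ) = (Complex.exp (-(Complex.I * (‖k‖ * (t + s) : ℝ))) -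
      Complex.exp (Complex.I * (‖k‖ * (t + s) : ℝ))) * Complex.I / 2 := by
    rw [Complex.sin]; ring_nf
  rw [kirchhoffSymbol, mul_div_left_comm ⟪v, k⟫, Complex.ofReal_mul _ (⟪v, k⟫ / ‖k‖),
    Complex.ofReal_sin, hsin, Complex.ofReal_cos, hcos]
  have e1 : Complex.exp (Complex.I * (1 * ‖k‖ * t : ℝ)) *
      Complex.exp (Complex.I * (s * (⟪k, v⟫ + 1 * ‖k‖) : ℝ)) *
      Complex.exp (Complex.I * (⟪k, z⟫ : ℝ)) = Complex.exp (Complex.I * (⟪k, z + s • v⟫ : ℝ)) *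
        Complex.exp (Complex.I * (‖k‖ * (t + s) : ℝ)) := by
    rw [inner_add_right, inner_smul_right, ← Complex.exp_add, ← Complex.exp_add, ← Complex.exp_add]
    push_cast
    ring_nf
  have e2 : Complex.exp (Complex.I * (-1 * ‖k‖ * t : ℝ)) *
      Complex.exp (Complex.I * (s * (⟪k, v⟫ + -1 * ‖k‖) : ℝ)) *
      Complex.exp (Complex.I * (⟪k, z⟫ : ℝ)) = Complex.exp (Complex.I * (⟪k, z + s • v⟫ : ℝ)) *
        Complex.exp (-(Complex.I * (‖k‖ * (t + s) : ℝ))) := by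
    rw [inner_add_right, inner_smul_right, ← Complex.exp_add, ← Complex.exp_add, ← Complex.exp_add]
    push_cast
    ring_nf
  have hI := Complex.I_sq
  generalize ⟪v, k⟫ / ‖k‖ = a at *
  generalize Complex.exp (Complex.I * (⟪k, z + s • v⟫ : ℝ)) = X at *
  generalize Complex.exp (Complex.I * (‖k‖ * (t + s) : ℝ)) = Y at *
  generalize Complex.exp (-(Complex.I * (‖k‖ * (t + s) : ℝ))) = Y' at *
  push_cast at *
  linear_combination (phiHat ρ v k * (1 - a) / 2) * e1 + (phiHat ρ v k * (1 + a) / 2) * e2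
    + phiHat ρ v k * X * (a * (Y' - Y) / 2) * hI

theorem phi0_eq_zero {ρ : E3 → ℝ} (hsmooth : ContDiff ℝ (⊤ : ℕ∞) ρ) (hc : HasCompactSupport ρ)
    {v : E3} (hv : ‖v‖ < 1) {R : ℝ} (hsupp : ∀ x : E3, R ≤ ‖x‖ → ρ x = 0) (q0 x : E3) {t : ℝ}
    (ht : 0 < t) (hx : ‖x - q0‖ ≤ t - R) : phi0 ρ q0 v x t = 0 := by
  set H : ℝ → ℂ := fun s => ∫ k, phiHat ρ v k *
    (Complex.exp (Complex.I * (⟪k, x - q0 + s • v⟫ : ℝ)) * kirchhoffSymbol v k (t + s)) with hH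
  have hder : ∀ s : ℝ, 0 ≤ s → HasDerivAt H 0 s := fun s hs => by
    refine (hasDerivAt_integral_phiHat_mul_kirchhoffSymbol hsmooth hc hv (x - q0) t s).congr_deriv
      (integral_ftrans_mul_sin_eq_zero hsmooth hc (by linarith) fun w hw => hsupp _ ?_)
    have h1 := norm_sub_le (x - q0 + s • v + w) (x - q0 + s • v)
    have h2 := norm_add_le (x - q0) (s • v)
    rw [add_sub_cancel_left, hw] at h1
    rw [norm_smul, norm_of_nonneg hs] at h2
    nlinarith
  have hconst : ∀ s : ℝ, 0 ≤ s → H s = H 0 := fun s hs =>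
    constant_of_has_deriv_right_zero
      (fun u hu => (hder u hu.1).continuousAt.continuousWithinAt)
      (fun u hu => (hder u hu.1).hasDerivWithinAt) s ⟨hs, le_rfl⟩
  have h0 : H 0 = 0 := tendsto_nhds_unique
    (tendsto_const_nhds.congr' ((eventually_ge_atTop 0).mono fun s hs => (hconst s hs).symm))
    (tendsto_integral_phiHat_mul_kirchhoffSymbol hsmooth hc hv (x - q0) t)
  simp only [hH, zero_smul, add_zero] at h0
  rw [phi0_eq hsmooth hc hv q0 x ht, h0]
  simp

/-- φ₀(x,t) vanishes for |x−q⁰| ≤ t−R_ρ, t > 0; consequently, for any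
continuous path q with |q(t)−q⁰| ≤ v̄ t (|v⁰| ≤ v̄ < 1), the force
F₀(t) = ∫ φ₀(x,t)∇ρ(x−q(t)) d³x vanishes for t ≥ t₁ = 2R_ρ/(1−v̄). -/
theorem free_field_force_vanishes
    (ρ : E3 → ℝ) (Rρ : ℝ) (hRρ : 0 < Rρ)
    (hsmooth : ContDiff ℝ (⊤ : ℕ∞) ρ)
    (hrad : ∀ x y : E3, ‖x‖ = ‖y‖ → ρ x = ρ y)
    (hsupp : ∀ x : E3, Rρ ≤ ‖x‖ → ρ x = 0)
    (q0 v0 : E3) (hv0 : ‖v0‖ < 1) :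
    (∀ (x : E3) (t : ℝ), 0 < t → ‖x - q0‖ ≤ t - Rρ → phi0 ρ q0 v0 x t = 0)
    ∧ ∀ vbar : ℝ, ‖v0‖ ≤ vbar → vbar < 1 →
        ∀ q : ℝ → E3, ContinuousOn q (Set.Ici 0) →
          (∀ t ∈ Set.Ici (0 : ℝ), ‖q t - q0‖ ≤ vbar * t) →
          ∀ t : ℝ, 2 * Rρ / (1 - vbar) ≤ t →
            (∫ x : E3, phi0 ρ q0 v0 x t • gradient ρ (x - q t)) = 0 := by
  have hc := hasCompactSupport_of_eq_zero hsupp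
  have hphi : ∀ (x : E3) (t : ℝ), 0 < t → ‖x - q0‖ ≤ t - Rρ → phi0 ρ q0 v0 x t = 0 :=
    fun x t ht hx => phi0_eq_zero hsmooth hc hv0 hsupp q0 x ht hx
  refine ⟨hphi, fun vbar _ hvbar q _ hq t ht => ?_⟩
  rw [div_le_iff₀ (by linarith)] at ht
  have htpos : 0 < t := by nlinarith
  refine (integral_congr_ae (.of_forall fun x => ?_)).trans (integral_zero E3 E3)
  rcases le_or_gt ‖x - q t‖ Rρ with hx | hx
  · rw [hphi x t htpos ?_, zero_smul]
    have h1 := norm_add_le (x - q t) (q t - q0)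
    rw [sub_add_sub_cancel] at h1
    linarith [hq t htpos.le]
  · have h1 : ρ =ᶠ[nhds (x - q t)] fun _ => 0 :=
      (continuous_norm.continuousAt.eventually (lt_mem_nhds hx)).mono fun y hy => hsupp y hy.le
    rw [h1.gradient_eq, gradient_fun_const, smul_zero]
end
end
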